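/- arXiv:2302.12603 — 4 statements merged into one kernel-verified Lean document; each statement's English description precedes it below -/
import Mathlib

section
/- Suppose x' = A(t)x admits an exponential dichotomy with constants D, ρ > 0 and that the Lipschitz condition holds with c(t) = c constant, where q̃ := 2cD/ρ < 1. Given ε > 0, for each λ ∈ Σ let y_λ : ℝ → X be differentiable with |y_λ'(t) − A(t)y_λ(t) − f_λ(t, y_λ(t))| ≤ ε for all t ∈ ℝ. Then for each λ ∈ Σ there exists a unique differentiable x_λ : ℝ → X with x_λ'(t) = A(t)x_λ(t) + f_λ(t, x_λ(t)) for all t ∈ ℝ and sup_{t∈ℝ}|x_λ(t) − y_λ(t)| ≤ L̃/(1−q̃), where L̃ := 2εD/ρ. -/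
open MeasureTheory Set

/-- Solutions of a linear differential equation with continuous bounded coefficients are determined
by their value at one time. -/
theorem linearODE_unique {X : Type*} [NormedAddCommGroup X] [NormedSpace ℝ X]
    {A : ℝ → X →L[ℝ] X} (hA : Continuous A) {u v : ℝ → X}
    (hu : ∀ t, HasDerivAt u (A t (u t)) t) (hv : ∀ t, HasDerivAt v (A t (v t)) t)
    {s : ℝ} (h : u s = v s) (t : ℝ) : u t = v t := by
  set a := min s t - 1
  set b := max s t + 1
  have hs : s ∈ Ioo a b := ⟨by linarith [min_le_left s t], by linarith [le_max_left s t]⟩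
  have ht : t ∈ Ioo a b := ⟨by linarith [min_le_right s t], by linarith [le_max_right s t]⟩
  obtain ⟨K, hK⟩ := (isCompact_Icc (a := a) (b := b)).exists_bound_of_continuousOn hA.continuousOn
  refine ODE_solution_unique_of_mem_Ioo (v := fun t x => A t x) (s := fun _ => univ)
    (K := K.toNNReal) (fun r hr => ?_) hs (fun r _ => ⟨hu r, mem_univ _⟩)
    (fun r _ => ⟨hv r, mem_univ _⟩) h ht
  refine ((A r).lipschitz.weaken ?_).lipschitzOnWith
  exact NNReal.le_toNNReal_of_coe_le (hK r (Ioo_subset_Icc_self hr))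

/-- A fundamental solution `U` of `x' = A(t)x`, its inverse `V`, and an operator `Q` such that the
kernel `U(t) Q V(s)` for `s ≤ t`, `-U(t) (1 - Q) V(s)` for `t < s`, decays exponentially. -/
structure FundamentalDichotomy {X : Type*} [NormedAddCommGroup X] [NormedSpace ℝ X]
    (A U V : ℝ → X →L[ℝ] X) (Q : X →L[ℝ] X) (D ρ : ℝ) : Prop where
  mul_inv : ∀ t x, U t (V t x) = x
  inv_mul : ∀ t x, V t (U t x) = x
  deriv_fund : ∀ t, HasDerivAt U ((A t).comp (U t)) t
  deriv_inv : ∀ t, HasDerivAt V (-((V t).comp (A t))) t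
  const_pos : 0 < D
  rate_pos : 0 < ρ
  stable : ∀ t s, s ≤ t → ∀ x, ‖U t (Q (V s x))‖ ≤ D * Real.exp (-ρ * (t - s)) * ‖x‖
  unstable : ∀ t s, t < s → ∀ x, ‖U t ((1 - Q) (V s x))‖ ≤ D * Real.exp (-ρ * (s - t)) * ‖x‖

/-- An exponential dichotomy of an evolution family, expressed through the fundamental solution
`t ↦ T(t, 0)`. -/
theorem FundamentalDichotomy.of_evolution {X : Type*} [NormedAddCommGroup X] [NormedSpace ℝ X]
    [CompleteSpace X] {A : ℝ → X →L[ℝ] X} (hA : Continuous A) {T : ℝ → ℝ → X →L[ℝ] X}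
    (hTid : ∀ s, T s s = 1)
    (hT : ∀ s t, HasDerivAt (fun r => T r s) ((A t).comp (T t s)) t)
    {P : ℝ → X →L[ℝ] X} (hcomm : ∀ t s, (T t s).comp (P s) = (P t).comp (T t s))
    {G : ℝ → ℝ → X →L[ℝ] X}
    (hG : ∀ t s, G t s = if s ≤ t then (T t s).comp (P s)
      else -((T t s).comp (1 - P s)))
    {D ρ : ℝ} (hD : 0 < D) (hρ : 0 < ρ)
    (hdich : ∀ t s, ‖G t s‖ ≤ D * Real.exp (-ρ * |t - s|)) :
    FundamentalDichotomy A (fun t => T t 0) (fun t => T 0 t) (P 0) D ρ := by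
  have hTx : ∀ s x t, HasDerivAt (fun r => T r s x) (A t (T t s x)) t := fun s x t => by
    simpa using (hT s t).clm_apply (hasDerivAt_const t x)
  have hcoc : ∀ t s r x, T t s (T s r x) = T t r x := fun t s r x =>
    linearODE_unique hA (hTx s (T s r x)) (hTx r x) (s := s) (by simp [hTid]) t
  have hcommx : ∀ t s x, T t s (P s x) = P t (T t s x) := fun t s x =>
    DFunLike.congr_fun (hcomm t s) x
  refine ⟨fun t x => by simp [hcoc, hTid], fun t x => by simp [hcoc, hTid], fun t => hT 0 t, ?_,
    hD, hρ, ?_, ?_⟩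
  · intro t
    let u : ℝ → (X →L[ℝ] X)ˣ := fun t => ⟨T t 0, T 0 t,
      by ext x; simp [hcoc, hTid], by ext x; simp [hcoc, hTid]⟩
    have h1 : (fun t => T 0 t) = fun t => Ring.inverse (T t 0) := by
      funext r
      exact (Ring.inverse_unit (u r)).symm
    rw [h1]
    have h2 := (hasFDerivAt_ringInverse (𝕜 := ℝ) (u t)).comp_hasDerivAt t (hT 0 t)
    refine h2.congr_deriv ?_
    ext x
    change -(T 0 t (A t (T t 0 (T 0 t x)))) = -(T 0 t (A t x))
    rw [hcoc, hTid]
    rfl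
  · intro t s hst x
    have h := (G t s).le_of_opNorm_le (hdich t s) x
    rw [hG, if_pos hst, abs_of_nonneg (by linarith)] at h
    have e : T t 0 (P 0 (T 0 s x)) = T t s (P s x) := by rw [hcommx, hcoc, hcommx]
    exact (congrArg norm e).trans_le h
  · intro t s hts x
    have h := (G t s).le_of_opNorm_le (hdich t s) x
    rw [hG, if_neg hts.not_ge, abs_of_neg (by linarith), neg_sub, neg_apply,
      norm_neg] at h
    have e : T t 0 ((1 - P 0) (T 0 s x)) = T t s ((1 - P s) x) := by
      simp [hcommx, hcoc]
    exact (congrArg norm e).trans_le h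

/-- A function whose values and derivatives decay exponentially towards `-∞`, measured from `t`, is
bounded at `t` by the integral of the derivative bound. -/
theorem norm_le_of_norm_deriv_le_exp {X : Type*} [NormedAddCommGroup X] [NormedSpace ℝ X]
    {u u' : ℝ → X} {t M K ρ : ℝ} (hρ : 0 < ρ) (hK : 0 ≤ K)
    (hu : ∀ s, HasDerivAt u (u' s) s)
    (hM : ∀ s < t, ‖u s‖ ≤ M * Real.exp (-ρ * (t - s)))
    (hu' : ∀ s < t, ‖u' s‖ ≤ K * Real.exp (-ρ * (t - s))) : ‖u t‖ ≤ K / ρ := by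
  have key : ∀ s < t, ‖u t‖ ≤ M * Real.exp (-ρ * (t - s)) + K / ρ := by
    intro s hs
    have hB : ∀ r, HasDerivAt
        (fun r => M * Real.exp (-ρ * (t - s)) + K / ρ * Real.exp (-ρ * (t - r)))
        (K * Real.exp (-ρ * (t - r))) r := by
      intro r
      have h1 : HasDerivAt (fun r => -ρ * (t - r)) ρ r := by
        simpa using ((hasDerivAt_id r).const_sub t).const_mul (-ρ)
      refine ((h1.exp.const_mul (K / ρ)).const_add _).congr_deriv ?_
      field_simp
    have h := image_norm_le_of_norm_deriv_right_le_deriv_boundary (f := u) (f' := u')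
      (B := fun r => M * Real.exp (-ρ * (t - s)) + K / ρ * Real.exp (-ρ * (t - r)))
      (a := s) (b := t) (fun r _ => (hu r).continuousAt.continuousWithinAt)
      (fun r _ => (hu r).hasDerivWithinAt)
      ((hM s hs).trans (le_add_of_nonneg_right (by positivity))) hB
      (fun r hr => hu' r hr.2) (right_mem_Icc.2 hs.le)
    simpa using h
  have hlim : Filter.Tendsto (fun s => M * Real.exp (-ρ * (t - s)) + K / ρ) Filter.atBot
      (nhds (M * 0 + K / ρ)) := by
    refine ((Real.tendsto_exp_atBot.comp ?_).const_mul M).add_const _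
    have : (fun s => -ρ * (t - s)) = fun s => ρ * s + -ρ * t := by
      funext s; ring
    rw [this]
    exact Filter.tendsto_atBot_add_const_right _ _ (Filter.tendsto_id.const_mul_atBot hρ)
  rw [mul_zero, zero_add] at hlim
  exact ge_of_tendsto hlim ((Filter.eventually_lt_atBot t).mono key)

/-- A bounded solution of `z' = A(t)z + k(t)` is controlled by the bound on `k`. -/
theorem FundamentalDichotomy.norm_le_of_bounded {X : Type*} [NormedAddCommGroup X]
    [NormedSpace ℝ X] {A U V : ℝ → X →L[ℝ] X} {Q : X →L[ℝ] X} {D ρ : ℝ}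
    (h : FundamentalDichotomy A U V Q D ρ) {z k : ℝ → X} {M K : ℝ}
    (hz : ∀ t, HasDerivAt z (A t (z t) + k t) t) (hM : ∀ t, ‖z t‖ ≤ M) (hk : ∀ t, ‖k t‖ ≤ K)
    (t : ℝ) : ‖z t‖ ≤ 2 * K * D / ρ := by
  have hD := h.const_pos
  have hρ := h.rate_pos
  have hK : 0 ≤ K := (norm_nonneg _).trans (hk 0)
  have hd : ∀ (R : X →L[ℝ] X) s,
      HasDerivAt (fun s => U t (R (V s (z s)))) (U t (R (V s (k s)))) s := by
    intro R s
    have h1 := ((h.deriv_inv s).clm_apply (hz s))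
    have h2 := ((U t).comp R).hasFDerivAt.comp_hasDerivAt s h1
    refine h2.congr_deriv ?_
    simp
  have hs : ‖U t (Q (V t (z t)))‖ ≤ (D * K) / ρ := by
    refine norm_le_of_norm_deriv_le_exp (M := D * M) hρ (by positivity) (hd Q)
      (fun s hs => ?_) (fun s hs => ?_)
    · refine (h.stable t s hs.le _).trans ?_
      rw [mul_right_comm]
      gcongr
      exact hM s
    · refine (h.stable t s hs.le _).trans ?_
      rw [mul_right_comm]
      gcongr
      exact hk s
  have hu : ‖U t ((1 - Q) (V t (z t)))‖ ≤ (D * K) / ρ := by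
    have hd' : ∀ s, HasDerivAt (fun s => U t ((1 - Q) (V (2 * t - s) (z (2 * t - s)))))
        (-(U t ((1 - Q) (V (2 * t - s) (k (2 * t - s)))))) s := by
      intro s
      have h1 : HasDerivAt (fun s => 2 * t - s) (-1) s := by
        simpa using (hasDerivAt_id s).const_sub (2 * t)
      simpa using! (hd (1 - Q) (2 * t - s)).scomp s h1
    have := norm_le_of_norm_deriv_le_exp (t := t) (M := D * M) (K := D * K) hρ (by positivity) hd'
      (fun s hs => ?_) (fun s hs => ?_)
    · simpa [two_mul] using this
    · refine (h.unstable t (2 * t - s) (by linarith) _).trans ?_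
      rw [mul_right_comm, show 2 * t - s - t = t - s by ring]
      gcongr
      exact hM _
    · rw [norm_neg]
      refine (h.unstable t (2 * t - s) (by linarith) _).trans ?_
      rw [mul_right_comm, show 2 * t - s - t = t - s by ring]
      gcongr
      exact hk _
  have hsplit : z t = U t (Q (V t (z t))) + U t ((1 - Q) (V t (z t))) := by
    rw [← map_add, ← add_apply, add_sub_cancel, one_apply_eq_self,
      h.mul_inv]
  calc ‖z t‖ = ‖U t (Q (V t (z t))) + U t ((1 - Q) (V t (z t)))‖ := congrArg _ hsplit
    _ ≤ D * K / ρ + D * K / ρ := norm_add_le_of_le hs hu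
    _ = 2 * K * D / ρ := by ring

theorem integrableOn_exp_neg_mul_sub_Iic {ρ : ℝ} (hρ : 0 < ρ) (t : ℝ) :
    IntegrableOn (fun s => Real.exp (-ρ * (t - s))) (Iic t) := by
  have : (fun s => Real.exp (-ρ * (t - s))) = fun s => Real.exp (-ρ * t) * Real.exp (ρ * s) := by
    funext s; rw [← Real.exp_add]; ring_nf
  rw [this]
  exact (integrableOn_exp_mul_Iic hρ t).const_mul _

theorem integral_exp_neg_mul_sub_Iic {ρ : ℝ} (hρ : 0 < ρ) (t : ℝ) :
    ∫ s in Iic t, Real.exp (-ρ * (t - s)) = 1 / ρ := by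
  have : (fun s => Real.exp (-ρ * (t - s))) = fun s => Real.exp (-ρ * t) * Real.exp (ρ * s) := by
    funext s; rw [← Real.exp_add]; ring_nf
  rw [this, integral_const_mul, integral_exp_mul_Iic hρ, ← mul_div_assoc, ← Real.exp_add]
  simp

theorem integrableOn_exp_neg_mul_sub_Ioi {ρ : ℝ} (hρ : 0 < ρ) (t : ℝ) :
    IntegrableOn (fun s => Real.exp (-ρ * (s - t))) (Ioi t) := by
  have : (fun s => Real.exp (-ρ * (s - t))) = fun s => Real.exp (ρ * t) * Real.exp (-ρ * s) := by
    funext s; rw [← Real.exp_add]; ring_nf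
  rw [this]
  exact (integrableOn_exp_mul_Ioi (neg_neg_of_pos hρ) t).const_mul _

theorem integral_exp_neg_mul_sub_Ioi {ρ : ℝ} (hρ : 0 < ρ) (t : ℝ) :
    ∫ s in Ioi t, Real.exp (-ρ * (s - t)) = 1 / ρ := by
  have : (fun s => Real.exp (-ρ * (s - t))) = fun s => Real.exp (ρ * t) * Real.exp (-ρ * s) := by
    funext s; rw [← Real.exp_add]; ring_nf
  rw [this, integral_const_mul, integral_exp_mul_Ioi (neg_neg_of_pos hρ), neg_div_neg_eq,
    ← mul_div_assoc, ← Real.exp_add]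
  simp

/-- If `U ∘ a` is dominated on a set by an integrable scalar function, then so is `a`, and the
image of the integral of `a` is bounded by the integral of the dominating function. -/
theorem integrableOn_and_norm_map_integral_le {X : Type*} [NormedAddCommGroup X]
    [NormedSpace ℝ X] [CompleteSpace X] {S : Set ℝ} (hS : MeasurableSet S) {B C : X →L[ℝ] X}
    (hCB : ∀ x, C (B x) = x) {a : ℝ → X} (ha : AEStronglyMeasurable a (volume.restrict S))
    {g : ℝ → ℝ} (hg : IntegrableOn g S) (hle : ∀ s ∈ S, ‖B (a s)‖ ≤ g s) :
    IntegrableOn a S ∧ ‖B (∫ s in S, a s)‖ ≤ ∫ s in S, g s := by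
  have hae : ∀ᵐ s ∂volume.restrict S, ‖B (a s)‖ ≤ g s :=
    (ae_restrict_iff' hS).2 (.of_forall hle)
  have hBa : IntegrableOn (fun s => B (a s)) S :=
    Integrable.mono' hg (B.continuous.comp_aestronglyMeasurable ha) hae
  have hint : IntegrableOn a S := by
    simpa only [IntegrableOn, hCB] using C.integrable_comp hBa
  refine ⟨hint, ?_⟩
  rw [← B.integral_comp_comm hint]
  exact norm_integral_le_of_norm_le hg hae

/-- A bounded strongly measurable forcing term admits a bounded mild solution. -/
theorem FundamentalDichotomy.exists_bounded_mild {X : Type*} [NormedAddCommGroup X]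
    [NormedSpace ℝ X] [CompleteSpace X] {A U V : ℝ → X →L[ℝ] X} {Q : X →L[ℝ] X} {D ρ : ℝ}
    (h : FundamentalDichotomy A U V Q D ρ) {k : ℝ → X} (hkm : StronglyMeasurable k) {K : ℝ}
    (hk : ∀ t, ‖k t‖ ≤ K) :
    (∀ a b, IntervalIntegrable (fun s => V s (k s)) volume a b) ∧
    ∃ w : BoundedContinuousFunction ℝ X, ∃ C : X,
      ∀ t, w t = U t (C + ∫ s in (0 : ℝ)..t, V s (k s)) := by
  have hD := h.const_pos
  have hρ := h.rate_pos
  have hUc : Continuous U := continuous_iff_continuousAt.2 fun t => (h.deriv_fund t).continuousAt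
  have hVc : Continuous V := continuous_iff_continuousAt.2 fun t => (h.deriv_inv t).continuousAt
  have hm : StronglyMeasurable (fun s => V s (k s)) :=
    isBoundedBilinearMap_apply.continuous.comp_stronglyMeasurable
      (hVc.stronglyMeasurable.prodMk hkm)
  have hint : ∀ a b, IntervalIntegrable (fun s => V s (k s)) volume a b := fun a b =>
    ((hVc.norm.mul continuous_const).intervalIntegrable a b).mono_fun' (g := fun s => ‖V s‖ * K)
      hm.aestronglyMeasurable (.of_forall fun s => (V s).le_opNorm_of_le (hk s))
  refine ⟨hint, ?_⟩
  have hp : ∀ t, IntegrableOn (fun s => Q (V s (k s))) (Iic t) ∧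
      ‖U t (∫ s in Iic t, Q (V s (k s)))‖ ≤ D * K / ρ := by
    intro t
    have := integrableOn_and_norm_map_integral_le measurableSet_Iic (h.inv_mul t)
      (Q.continuous.comp_stronglyMeasurable hm).aestronglyMeasurable
      ((integrableOn_exp_neg_mul_sub_Iic hρ t).const_mul (D * K)) fun s hs => by
        refine (h.stable t s hs _).trans ?_
        rw [mul_right_comm]
        gcongr
        exact hk s
    rwa [integral_const_mul, integral_exp_neg_mul_sub_Iic hρ, mul_one_div] at this
  have hq : ∀ t, IntegrableOn (fun s => (1 - Q) (V s (k s))) (Ioi t) ∧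
      ‖U t (∫ s in Ioi t, (1 - Q) (V s (k s)))‖ ≤ D * K / ρ := by
    intro t
    have := integrableOn_and_norm_map_integral_le measurableSet_Ioi (h.inv_mul t)
      ((1 - Q).continuous.comp_stronglyMeasurable hm).aestronglyMeasurable
      ((integrableOn_exp_neg_mul_sub_Ioi hρ t).const_mul (D * K)) fun s hs => by
        refine (h.unstable t s hs _).trans ?_
        rw [mul_right_comm]
        gcongr
        exact hk s
    rwa [integral_const_mul, integral_exp_neg_mul_sub_Ioi hρ, mul_one_div] at this
  set C := (∫ s in Iic (0 : ℝ), Q (V s (k s))) - ∫ s in Ioi (0 : ℝ), (1 - Q) (V s (k s))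
  have hC : ∀ t, C + ∫ s in (0 : ℝ)..t, V s (k s) =
      (∫ s in Iic t, Q (V s (k s))) - ∫ s in Ioi t, (1 - Q) (V s (k s)) := by
    intro t
    have h1 := intervalIntegral.integral_Iic_sub_Iic (hp 0).1 (hp t).1
    have h2 := intervalIntegral.integral_interval_add_Ioi (hq 0).1 (hq t).1
    have h3 : ∫ s in (0 : ℝ)..t, V s (k s) =
        (∫ s in (0 : ℝ)..t, Q (V s (k s))) + ∫ s in (0 : ℝ)..t, (1 - Q) (V s (k s)) := by
      rw [Q.intervalIntegral_comp_comm (hint 0 t), (1 - Q).intervalIntegral_comp_comm (hint 0 t),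
        ← add_apply, add_sub_cancel, one_apply_eq_self]
    rw [h3, ← h1]
    simp only [C]
    rw [← h2]
    abel
  have hcont : Continuous fun t => U t (C + ∫ s in (0 : ℝ)..t, V s (k s)) :=
    hUc.clm_apply (continuous_const.add (intervalIntegral.continuous_primitive hint 0))
  refine ⟨BoundedContinuousFunction.ofNormedAddCommGroup _ hcont (D * K / ρ + D * K / ρ)
    fun t => ?_, C, fun t => rfl⟩
  rw [hC, map_sub]
  exact norm_sub_le_of_le (hp t).2 (hq t).2

/-- The variation of constants formula with continuous forcing yields a classical solution. -/
theorem FundamentalDichotomy.hasDerivAt_mild {X : Type*} [NormedAddCommGroup X]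
    [NormedSpace ℝ X] [CompleteSpace X] {A U V : ℝ → X →L[ℝ] X} {Q : X →L[ℝ] X} {D ρ : ℝ}
    (h : FundamentalDichotomy A U V Q D ρ) {k x : ℝ → X} (hk : Continuous k) {C : X}
    (hx : ∀ t, x t = U t (C + ∫ s in (0 : ℝ)..t, V s (k s))) (t : ℝ) :
    HasDerivAt x (A t (x t) + k t) t := by
  have hVc : Continuous V := continuous_iff_continuousAt.2 fun t => (h.deriv_inv t).continuousAt
  have h1 := ((hVc.clm_apply hk).integral_hasStrictDerivAt 0 t).hasDerivAt.const_add C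
  have h2 := (h.deriv_fund t).clm_apply h1
  rw [funext hx]
  refine h2.congr_deriv ?_
  simp [h.mul_inv]

/-- Shadowing of an approximate solution of a semilinear equation by an exact one at bounded
distance. -/
theorem FundamentalDichotomy.exists_shadowing {X : Type*} [NormedAddCommGroup X]
    [NormedSpace ℝ X] [CompleteSpace X] {A U V : ℝ → X →L[ℝ] X} {Q : X →L[ℝ] X} {D ρ : ℝ}
    (h : FundamentalDichotomy A U V Q D ρ) (hA : Continuous A) {f : ℝ → X → X}
    (hf : Continuous fun p : ℝ × X => f p.1 p.2) {c : ℝ} (hc0 : 0 ≤ c)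
    (hlip : ∀ t x₁ x₂, ‖f t x₁ - f t x₂‖ ≤ c * ‖x₁ - x₂‖) (hq : 2 * c * D / ρ < 1)
    {eps : ℝ} {y y' : ℝ → X} (hy : ∀ t, HasDerivAt y (y' t) t)
    (hpse : ∀ t, ‖y' t - A t (y t) - f t (y t)‖ ≤ eps) :
    ∃ x : ℝ → X, (∀ t, HasDerivAt x (A t (x t) + f t (x t)) t) ∧ ∃ M, ∀ t, ‖x t - y t‖ ≤ M := by
  have hD := h.const_pos
  have hρ := h.rate_pos
  have hVc : Continuous V := continuous_iff_continuousAt.2 fun t => (h.deriv_inv t).continuousAt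
  have hyc : Continuous y := continuous_iff_continuousAt.2 fun t => (hy t).continuousAt
  have hy'm : StronglyMeasurable y' := by
    rw [← funext fun t => (hy t).deriv]
    exact stronglyMeasurable_deriv y
  have hfw : ∀ w : BoundedContinuousFunction ℝ X, Continuous fun t => f t (y t + w t) := fun w =>
    hf.comp (continuous_id.prodMk (hyc.add w.continuous))
  have hAy : Continuous fun t => A t (y t) := hA.clm_apply hyc
  let F : BoundedContinuousFunction ℝ X → ℝ → X := fun w t =>
    f t (y t + w t) - (y' t - A t (y t))
  have hFm : ∀ w, StronglyMeasurable (F w) := fun w =>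
    (hfw w).stronglyMeasurable.sub (hy'm.sub hAy.stronglyMeasurable)
  have hFb : ∀ w t, ‖F w t‖ ≤ c * ‖w‖ + eps := by
    intro w t
    have h1 : F w t = (f t (y t + w t) - f t (y t)) - (y' t - A t (y t) - f t (y t)) := by
      simp only [F]; abel
    rw [h1]
    refine norm_sub_le_of_le ((hlip t _ _).trans ?_) (hpse t)
    rw [add_sub_cancel_left]
    gcongr
    exact w.norm_coe_le_norm t
  have hFint : ∀ w a b, IntervalIntegrable (fun s => V s (F w s)) volume a b := fun w =>
    (h.exists_bounded_mild (hFm w) (hFb w)).1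
  choose Φ C hΦ using fun w => (h.exists_bounded_mild (hFm w) (hFb w)).2
  have hcontr : ContractingWith ⟨2 * c * D / ρ, by positivity⟩ Φ := by
    refine ⟨hq, LipschitzWith.of_dist_le_mul fun w₁ w₂ => ?_⟩
    have hq0 : 0 ≤ 2 * c * D / ρ := by positivity
    refine (BoundedContinuousFunction.dist_le (mul_nonneg hq0 dist_nonneg)).2 fun t => ?_
    have hdiff : ∀ t, (Φ w₁ - Φ w₂) t = U t ((C w₁ - C w₂) +
        ∫ s in (0 : ℝ)..t, V s (f s (y s + w₁ s) - f s (y s + w₂ s))) := by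
      intro t
      have h1 : ∫ s in (0 : ℝ)..t, V s (f s (y s + w₁ s) - f s (y s + w₂ s)) =
          (∫ s in (0 : ℝ)..t, V s (F w₁ s)) - ∫ s in (0 : ℝ)..t, V s (F w₂ s) := by
        rw [← intervalIntegral.integral_sub (hFint w₁ 0 t) (hFint w₂ 0 t)]
        refine intervalIntegral.integral_congr fun s _ => ?_
        simp only [F, ← map_sub]
        congr 1
        abel
      rw [BoundedContinuousFunction.sub_apply, hΦ, hΦ, h1, ← map_sub]
      congr 1
      abel
    have hb := h.norm_le_of_bounded (K := c * dist w₁ w₂)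
      (h.hasDerivAt_mild ((hfw w₁).sub (hfw w₂)) hdiff)
      (fun t => (Φ w₁ - Φ w₂).norm_coe_le_norm t) (fun t => by
        refine (hlip t _ _).trans ?_
        rw [add_sub_add_left_eq_sub, ← dist_eq_norm]
        gcongr
        exact BoundedContinuousFunction.dist_coe_le_dist t) t
    rw [dist_eq_norm]
    refine hb.trans_eq ?_
    change _ = 2 * c * D / ρ * dist w₁ w₂
    ring
  set w := hcontr.fixedPoint
  have hw : Φ w = w := hcontr.fixedPoint_isFixedPt
  have hi : ∀ t, IntervalIntegrable (fun s => V s (y' s - A s (y s))) volume 0 t := by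
    intro t
    have := ((hVc.clm_apply (hfw w)).intervalIntegrable 0 t).sub (hFint w 0 t)
    refine this.congr fun s _ => ?_
    simp [F]
  have hfy : ∀ t, y t = U t (V 0 (y 0) + ∫ s in (0 : ℝ)..t, V s (y' s - A s (y s))) := by
    intro t
    have hd : ∀ s, HasDerivAt (fun s => V s (y s)) (V s (y' s - A s (y s))) s := by
      intro s
      refine ((h.deriv_inv s).clm_apply (hy s)).congr_deriv ?_
      simp only [neg_apply, ContinuousLinearMap.comp_apply, map_sub]
      abel
    rw [intervalIntegral.integral_eq_sub_of_hasDerivAt (fun s _ => hd s) (hi t), add_sub_cancel,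
      h.mul_inv]
  refine ⟨fun t => y t + w t, ?_, ‖w‖, fun t => by
    simpa using w.norm_coe_le_norm t⟩
  refine h.hasDerivAt_mild (C := V 0 (y 0) + C w) (hfw w) fun t => ?_
  have hsum : ∫ s in (0 : ℝ)..t, V s (f s (y s + w s)) =
      (∫ s in (0 : ℝ)..t, V s (y' s - A s (y s))) + ∫ s in (0 : ℝ)..t, V s (F w s) := by
    rw [← intervalIntegral.integral_add (hi t) (hFint w 0 t)]
    refine intervalIntegral.integral_congr fun s _ => ?_
    simp only [F, ← map_add, add_sub_cancel]
  have hwt : w t = U t (C w + ∫ s in (0 : ℝ)..t, V s (F w s)) := by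
    rw [← hΦ, hw]
  rw [hsum, hwt]
  nth_rewrite 1 [hfy t]
  rw [← map_add]
  congr 1
  abel

/-- An exact solution at bounded distance from a solution with defect at most `eps` is within the
distance predicted by the Green kernel. -/
theorem FundamentalDichotomy.norm_sub_le_of_defect {X : Type*} [NormedAddCommGroup X]
    [NormedSpace ℝ X] {A U V : ℝ → X →L[ℝ] X} {Q : X →L[ℝ] X} {D ρ : ℝ}
    (h : FundamentalDichotomy A U V Q D ρ) {f : ℝ → X → X} {c : ℝ} (hc0 : 0 ≤ c)
    (hlip : ∀ t x₁ x₂, ‖f t x₁ - f t x₂‖ ≤ c * ‖x₁ - x₂‖) (hq : 2 * c * D / ρ < 1)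
    {eps : ℝ} {y y' x : ℝ → X} (hy : ∀ t, HasDerivAt y (y' t) t)
    (hpse : ∀ t, ‖y' t - A t (y t) - f t (y t)‖ ≤ eps)
    (hx : ∀ t, HasDerivAt x (A t (x t) + f t (x t)) t) {M : ℝ} (hM : ∀ t, ‖x t - y t‖ ≤ M)
    (t : ℝ) : ‖x t - y t‖ ≤ (2 * eps * D / ρ) / (1 - 2 * c * D / ρ) := by
  set S := ⨆ t, ‖x t - y t‖
  have hS : ∀ t, ‖x t - y t‖ ≤ S := le_ciSup ⟨M, by rintro _ ⟨t, rfl⟩; exact hM t⟩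
  have hd : ∀ t, HasDerivAt (fun t => x t - y t) (A t (x t - y t) +
      ((f t (x t) - f t (y t)) - (y' t - A t (y t) - f t (y t)))) t := by
    intro t
    refine ((hx t).sub (hy t)).congr_deriv ?_
    rw [map_sub]
    abel
  have hb := h.norm_le_of_bounded (K := c * S + eps) hd hM fun t =>
    norm_sub_le_of_le ((hlip t _ _).trans (by gcongr; exact hS t)) (hpse t)
  have hSle : S ≤ 2 * (c * S + eps) * D / ρ := ciSup_le hb
  refine (hS t).trans ((le_div_iff₀ (by linarith)).2 ?_)
  have : 2 * (c * S + eps) * D / ρ = S * (2 * c * D / ρ) + 2 * eps * D / ρ := by ring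
  linarith


/-- Corollary: parameterized Hyers–Ulam stability. If `x' = A(t)x`
admits an exponential dichotomy with constants `D, ρ > 0`, the Lipschitz constant of
`f_λ` is `c` with `q̃ := 2cD/ρ < 1`, and `y_λ` is an `ε`-approximate solution, then
there is a unique exact solution `x_λ` with
`sup_t ‖x_λ(t) − y_λ(t)‖ ≤ L̃/(1−q̃)`, where `L̃ = 2εD/ρ`. -/
theorem stmt10
    {X : Type*} [NormedAddCommGroup X] [NormedSpace ℝ X] [CompleteSpace X]
    {E : Type*} [NormedAddCommGroup E] [NormedSpace ℝ E]
    (A : ℝ → X →L[ℝ] X) (hA : Continuous A)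
    (T : ℝ → ℝ → X →L[ℝ] X)
    (hTid : ∀ s, T s s = 1)
    (hT : ∀ s t, HasDerivAt (fun r => T r s) ((A t).comp (T t s)) t)
    -- exponential dichotomy
    (P : ℝ → X →L[ℝ] X)
    (hproj : ∀ t, (P t).comp (P t) = P t)
    (hcomm : ∀ t s, (T t s).comp (P s) = (P t).comp (T t s))
    (G : ℝ → ℝ → X →L[ℝ] X)
    (hG : ∀ t s, G t s = if s ≤ t then (T t s).comp (P s)
      else -((T t s).comp (1 - P s)))
    (D ρ : ℝ) (hD : 0 < D) (hρ : 0 < ρ)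
    (hdich : ∀ t s, ‖G t s‖ ≤ D * Real.exp (-ρ * |t - s|))
    -- parameter set and nonlinearity
    (Sg : Set E) (hSg : IsOpen Sg) (hSgne : Sg.Nonempty)
    (f : E → ℝ → X → X)
    (hf : ∀ lam ∈ Sg, Continuous (fun p : ℝ × X => f lam p.1 p.2))
    (c : ℝ) (hc0 : 0 ≤ c)
    (hlip : ∀ lam ∈ Sg, ∀ t (x₁ x₂ : X),
      ‖f lam t x₁ - f lam t x₂‖ ≤ c * ‖x₁ - x₂‖)
    (hq : 2 * c * D / ρ < 1)
    -- approximate solutions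
    (eps : ℝ) (heps : 0 < eps)
    (y : E → ℝ → X) (y' : E → ℝ → X)
    (hy : ∀ lam ∈ Sg, ∀ t, HasDerivAt (y lam) (y' lam t) t)
    (hpse : ∀ lam ∈ Sg, ∀ t,
      ‖y' lam t - A t (y lam t) - f lam t (y lam t)‖ ≤ eps) :
    ∀ lam ∈ Sg, ∃! x : ℝ → X,
      (∀ t, HasDerivAt x (A t (x t) + f lam t (x t)) t) ∧
      ∀ t, ‖x t - y lam t‖ ≤ (2 * eps * D / ρ) / (1 - 2 * c * D / ρ) := by
  intro lam hlam
  have h := FundamentalDichotomy.of_evolution hA hTid hT hcomm hG hD hρ hdich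
  obtain ⟨x, hx, M, hM⟩ := h.exists_shadowing hA (hf lam hlam) hc0 (hlip lam hlam) hq
    (hy lam hlam) (hpse lam hlam)
  have hxy := h.norm_sub_le_of_defect hc0 (hlip lam hlam) hq (hy lam hlam) (hpse lam hlam) hx hM
  refine ⟨x, ⟨hx, hxy⟩, ?_⟩
  rintro x₁ ⟨hx₁, hx₁y⟩
  funext t
  have hle := h.norm_sub_le_of_defect hc0 (hlip lam hlam) hq (eps := 0) hx (by simp) hx₁
    (fun t => norm_sub_le_norm_sub_add_norm_sub (x₁ t) (y lam t) (x t) |>.trans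
      (add_le_add (hx₁y t) ((norm_sub_rev _ _).trans_le (hxy t)))) t
  simpa [sub_eq_zero] using hle
end

section
/- Suppose x' = A(t)x admits an exponential dichotomy with constants D, ρ > 0, the Lipschitz condition holds with constant c and q̃ := 2cD/ρ < 1. Take ε > 0 and k ∈ ℕ; for each λ ∈ Σ let y_λ : ℝ → X be differentiable with |y_λ'(t) − A(t)y_λ(t) − f_λ(t, y_λ(t))| ≤ ε for all t ∈ ℝ, and let x_λ be the unique solution of x' = A(t)x + f_λ(t,x) with sup_{t∈ℝ}|x_λ(t) − y_λ(t)| ≤ (2εD/ρ)/(1−q̃). Suppose there exists C > 0 such that: (i) for each t the map (λ,x) ↦ f_λ(t,x) is C^{k+1} with sup_{λ∈Σ} sup_{x∈X} ‖∂^i/(∂λ^{i−j}∂x^j) f_λ(t,x)‖ ≤ C for all 2 ≤ i ≤ k+1, 0 ≤ j ≤ i; (ii) for each t the maps λ ↦ y_λ(t) and λ ↦ y_λ'(t) are C^{k+1} with |∂^i_λ y_λ'(t) − A(t)∂^i_λ y_λ(t) − (d^i/dλ^i) f_λ(t, y_λ(t))| ≤ C for all 1 ≤ i ≤ k+1, t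 ∈ ℝ, λ ∈ Σ, and for every λ₀ ∈ Σ there exist M_{λ₀} > 1 and a neighborhood Σ₀ of λ₀ with max_{1≤i≤k+1} sup_{t∈ℝ} ‖∂^i_λ y_λ(t)‖ ≤ M_{λ₀} for all λ ∈ Σ₀. Then for each t ∈ ℝ the map λ ↦ x_λ(t) is C^k. -/
open MeasureTheory Set

universe u v w

open Filter Topology Asymptotics in
/-- If a linear isometry `ι` has complete domain and `ι ∘ F` is differentiable, so is `F`. -/
theorem LinearIsometry.exists_hasFDerivAt_of_comp {D V Y : Type*}
    [NormedAddCommGroup D] [NormedSpace ℝ D] [NormedAddCommGroup V] [NormedSpace ℝ V]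
    [CompleteSpace V] [NormedAddCommGroup Y] [NormedSpace ℝ Y] (ι : V →ₗᵢ[ℝ] Y)
    {F : D → V} {x : D} {L : D →L[ℝ] Y} (h : HasFDerivAt (fun d => ι (F d)) L x) :
    ∃ L' : D →L[ℝ] V, HasFDerivAt F L' x ∧ ι.toContinuousLinearMap.comp L' = L := by
  have hclosed : IsClosed (range ι) := ι.isometry.isClosedEmbedding.isClosed_range
  have hmem : ∀ e, ∃ v, ι v = L e := by
    intro e
    have hlim := h.lim_real e
    refine hclosed.mem_of_tendsto hlim (Eventually.of_forall fun c => ?_)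
    exact ⟨c • (F (x + c⁻¹ • e) - F x), by simp⟩
  choose g hg using hmem
  let L' : D →L[ℝ] V := LinearMap.mkContinuous
    { toFun := g
      map_add' := fun a b => ι.injective (by simp [hg])
      map_smul' := fun r a => ι.injective (by simp [hg]) } ‖L‖ (fun e => by
        rw [← ι.norm_map]
        simpa [hg] using L.le_opNorm e)
  have hL' : ι.toContinuousLinearMap.comp L' = L := by
    ext e
    exact hg e
  refine ⟨L', ?_, hL'⟩
  apply HasFDerivAt.of_isLittleO
  refine IsLittleO.of_norm_left (h.isLittleO.norm_left.congr_left fun y => ?_)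
  rw [← ι.norm_map, ← hL']
  simp

theorem LinearIsometry.contDiffOn_succ_of_comp {D V Y : Type*}
    [NormedAddCommGroup D] [NormedSpace ℝ D] [NormedAddCommGroup V] [NormedSpace ℝ V]
    [CompleteSpace V] [NormedAddCommGroup Y] [NormedSpace ℝ Y] (ι : V →ₗᵢ[ℝ] Y)
    {F : D → V} {O : Set D} (hO : IsOpen O) (n : ℕ)
    (hcomp : ∀ {G : D → D →L[ℝ] V},
      ContDiffOn ℝ n (fun d => ι.toContinuousLinearMap.comp (G d)) O → ContDiffOn ℝ n G O)
    (h : ContDiffOn ℝ (n + 1) (fun d => ι (F d)) O) : ContDiffOn ℝ (n + 1) F O := by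
  rw [contDiffOn_succ_iff_fderiv_of_isOpen hO] at h ⊢
  obtain ⟨hd, -, hf⟩ := h
  have key : ∀ d ∈ O, ∃ L' : D →L[ℝ] V, HasFDerivAt F L' d ∧
      ι.toContinuousLinearMap.comp L' = fderiv ℝ (fun d => ι (F d)) d := fun d hd' =>
    ι.exists_hasFDerivAt_of_comp ((hd d hd').differentiableAt (hO.mem_nhds hd')).hasFDerivAt
  refine ⟨fun d hd' => ?_, by simp, hcomp (hf.congr fun d hd' => ?_)⟩
  · obtain ⟨L', hL', -⟩ := key d hd'
    exact hL'.differentiableAt.differentiableWithinAt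
  · obtain ⟨L', hL', h'⟩ := key d hd'
    rw [hL'.fderiv, h']

/-- Postcomposition with a linear isometry, as a linear isometry of operator spaces. -/
noncomputable def LinearIsometry.postcompCLM (D : Type*) {V Y : Type*}
    [NormedAddCommGroup D] [NormedSpace ℝ D] [NormedAddCommGroup V] [NormedSpace ℝ V]
    [NormedAddCommGroup Y] [NormedSpace ℝ Y] (ι : V →ₗᵢ[ℝ] Y) :
    (D →L[ℝ] V) →ₗᵢ[ℝ] (D →L[ℝ] Y) where
  toLinearMap := (ContinuousLinearMap.compL ℝ D V Y ι.toContinuousLinearMap).toLinearMap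
  norm_map' := fun _ => ι.norm_toContinuousLinearMap_comp

theorem LinearIsometry.contDiffOn_zero_of_comp {D V Y : Type*}
    [NormedAddCommGroup D] [NormedSpace ℝ D] [NormedAddCommGroup V] [NormedSpace ℝ V]
    [NormedAddCommGroup Y] [NormedSpace ℝ Y] (ι : V →ₗᵢ[ℝ] Y)
    {F : D → V} {O : Set D} (h : ContDiffOn ℝ 0 (fun d => ι (F d)) O) : ContDiffOn ℝ 0 F O := by
  rw [contDiffOn_zero] at h ⊢
  exact ι.isometry.isEmbedding.continuousOn_iff.2 h

theorem LinearIsometry.contDiffOn_of_comp_aux {D : Type u}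
    [NormedAddCommGroup D] [NormedSpace ℝ D] {O : Set D} (hO : IsOpen O) (n : ℕ) :
    ∀ {V Y : Type max u v} [NormedAddCommGroup V] [NormedSpace ℝ V]
    [CompleteSpace V] [NormedAddCommGroup Y] [NormedSpace ℝ Y] (ι : V →ₗᵢ[ℝ] Y)
    {F : D → V}, ContDiffOn ℝ n (fun d => ι (F d)) O → ContDiffOn ℝ n F O := by
  induction n with
  | zero => exact fun ι => ι.contDiffOn_zero_of_comp
  | succ n ih =>
    intro V Y _ _ _ _ _ ι F h
    push_cast at h ⊢
    exact ι.contDiffOn_succ_of_comp hO n (fun {G} hG => ih (ι.postcompCLM D) hG) h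

/-- A map into a complete space is `C^n` as soon as it is so after a linear isometry. -/
theorem LinearIsometry.contDiffOn_of_comp {D : Type u}
    [NormedAddCommGroup D] [NormedSpace ℝ D] {O : Set D} (hO : IsOpen O) (n : ℕ)
    {V Y : Type v} [NormedAddCommGroup V] [NormedSpace ℝ V]
    [CompleteSpace V] [NormedAddCommGroup Y] [NormedSpace ℝ Y] (ι : V →ₗᵢ[ℝ] Y)
    {F : D → V} (h : ContDiffOn ℝ n (fun d => ι (F d)) O) : ContDiffOn ℝ n F O := by
  cases n with
  | zero => exact ι.contDiffOn_zero_of_comp h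
  | succ n =>
    push_cast at h ⊢
    exact ι.contDiffOn_succ_of_comp hO n (fun {G} hG =>
      LinearIsometry.contDiffOn_of_comp_aux.{u, v} hO n (ι.postcompCLM D) hG) h

/-- The sup-norm space of bounded families `ι → Z`. -/
abbrev BddFam (ι Z : Type*) [NormedAddCommGroup Z] : Type _ := lp (fun _ : ι => Z) ⊤

open Classical in
/-- The bounded family given by `g`, or `0` if `g` is unbounded. -/
noncomputable def toBddFam {ι Z : Type*} [NormedAddCommGroup Z] (g : ι → Z) : BddFam ι Z :=
  if h : Memℓp g ⊤ then ⟨g, h⟩ else 0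

theorem toBddFam_apply {ι Z : Type*} [NormedAddCommGroup Z] {g : ι → Z} {B : ℝ}
    (h : ∀ i, ‖g i‖ ≤ B) (i : ι) : toBddFam g i = g i := by
  have hg : Memℓp g ⊤ := memℓp_infty ⟨B, by rintro _ ⟨j, rfl⟩; exact h j⟩
  simp [toBddFam, hg]

theorem BddFam.norm_apply_le {ι Z : Type*} [NormedAddCommGroup Z] (m : BddFam ι Z) (i : ι) :
    ‖m i‖ ≤ ‖m‖ := lp.norm_apply_le_norm (by simp) m i

/-- A bounded family of operators, as an operator into bounded families. -/
noncomputable def BddFam.uncurryCLM (ι D Z : Type*) [NormedAddCommGroup D] [NormedSpace ℝ D]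
    [NormedAddCommGroup Z] [NormedSpace ℝ Z] : BddFam ι (D →L[ℝ] Z) →L[ℝ] (D →L[ℝ] BddFam ι Z) :=
  LinearMap.mkContinuous₂
    (LinearMap.mk₂ ℝ (fun (m : BddFam ι (D →L[ℝ] Z)) (d : D) =>
      (⟨fun i => m i d, memℓp_infty ⟨‖m‖ * ‖d‖, by
        rintro _ ⟨j, rfl⟩
        exact (m j).le_of_opNorm_le (m.norm_apply_le j) d⟩⟩ : BddFam ι Z))
      (fun _ _ _ => by ext; simp; rfl) (fun _ _ _ => by ext; simp)
      (fun _ _ _ => by ext; simp; rfl) (fun _ _ _ => by ext; simp)) 1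
    (fun m d => by
      refine lp.norm_le_of_forall_le (by positivity) fun i => ?_
      simpa using (m i).le_of_opNorm_le (m.norm_apply_le i) d)

@[simp]
theorem BddFam.uncurryCLM_apply {ι D Z : Type*} [NormedAddCommGroup D] [NormedSpace ℝ D]
    [NormedAddCommGroup Z] [NormedSpace ℝ Z] (m : BddFam ι (D →L[ℝ] Z)) (d : D) (i : ι) :
    BddFam.uncurryCLM ι D Z m d i = m i d := rfl

section Superposition

variable {ι D Z : Type*} [NormedAddCommGroup D] [NormedSpace ℝ D]
  [NormedAddCommGroup Z] [NormedSpace ℝ Z]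

theorem BddFam.contDiffOn_zero {φ : ι → D → Z} {Ω : Set D} (hΩ : IsOpen Ω)
    (hconv : Convex ℝ Ω) {B : ℝ} (hφ : ∀ i, DifferentiableOn ℝ (φ i) Ω)
    (hB : ∀ i, ∀ d ∈ Ω, ‖fderiv ℝ (φ i) d‖ ≤ B)
    {N : D → BddFam ι Z} (hN : ∀ d ∈ Ω, ∀ i, N d i = φ i d) :
    ContDiffOn ℝ 0 N Ω := by
  rw [_root_.contDiffOn_zero]
  refine (LipschitzOnWith.of_dist_le_mul (K := B.toNNReal) fun d hd d' hd' => ?_).continuousOn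
  rw [dist_eq_norm, dist_eq_norm]
  refine lp.norm_le_of_forall_le (by positivity) fun i => ?_
  simp only [lp.coeFn_sub, Pi.sub_apply, hN d hd, hN d' hd']
  have := hconv.norm_image_sub_le_of_norm_fderiv_le
    (fun e he => (hφ i e he).differentiableAt (hΩ.mem_nhds he))
    (fun e he => hB i e he) hd' hd
  refine this.trans ?_
  gcongr
  exact Real.le_coe_toNNReal B

open Filter Topology Asymptotics in
theorem BddFam.hasFDerivAt {φ : ι → D → Z} {Ω : Set D} (hΩ : IsOpen Ω)
    (hconv : Convex ℝ Ω) {B : ℝ} (hφ : ∀ i, ContDiffOn ℝ 2 (φ i) Ω)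
    (hB2 : ∀ i, ∀ d ∈ Ω, ‖iteratedFDeriv ℝ 2 (φ i) d‖ ≤ B)
    {N : D → BddFam ι Z} (hN : ∀ d ∈ Ω, ∀ i, N d i = φ i d)
    {d : D} (hd : d ∈ Ω) {N' : BddFam ι (D →L[ℝ] Z)} (hN' : ∀ i, N' i = fderiv ℝ (φ i) d) :
    HasFDerivAt N (BddFam.uncurryCLM ι D Z N') d := by
  have hB0 : 0 ≤ |B| := abs_nonneg B
  have hlip : ∀ i, ∀ e ∈ Ω, ‖fderiv ℝ (φ i) e - fderiv ℝ (φ i) d‖ ≤ |B| * ‖e - d‖ := by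
    intro i e he
    refine hconv.norm_image_sub_le_of_norm_fderiv_le (𝕜 := ℝ) (f := fderiv ℝ (φ i)) ?_ ?_ hd he
    · intro a ha
      exact ((((hφ i).fderiv_of_isOpen (m := 1) hΩ (by norm_num)) a ha).contDiffAt
        (hΩ.mem_nhds ha)).differentiableAt (by norm_num)
    · intro a ha
      rw [← norm_iteratedFDeriv_one, norm_iteratedFDeriv_fderiv]
      exact (hB2 i a ha).trans (le_abs_self B)
  obtain ⟨r, hr, hball⟩ := Metric.isOpen_iff.1 hΩ d hd
  apply HasFDerivAt.of_isLittleO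
  rw [isLittleO_iff]
  intro ε hε
  have h1 : ∀ᶠ e in 𝓝 d, e ∈ Metric.ball d (min r (ε / (|B| + 1))) :=
    Metric.ball_mem_nhds _ (by positivity)
  filter_upwards [h1] with e he
  have her : dist e d < r := lt_of_lt_of_le he (min_le_left _ _)
  have heε : dist e d < ε / (|B| + 1) := lt_of_lt_of_le he (min_le_right _ _)
  have heΩ : e ∈ Ω := hball her
  refine lp.norm_le_of_forall_le (by positivity) fun i => ?_
  have : (N e - N d - (BddFam.uncurryCLM ι D Z N') (e - d) : BddFam ι Z) i
      = φ i e - φ i d - fderiv ℝ (φ i) d (e - d) := by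
    simp [hN e heΩ, hN d hd, hN']
  rw [this]
  have hseg : segment ℝ d e ⊆ Ω := hconv.segment_subset hd heΩ
  have h2 := (convex_segment (𝕜 := ℝ) d e).norm_image_sub_le_of_norm_fderiv_le' (𝕜 := ℝ)
    (f := φ i) (φ := fderiv ℝ (φ i) d) (C := |B| * ‖e - d‖)
    (fun a ha => ((hφ i a (hseg ha)).contDiffAt (hΩ.mem_nhds (hseg ha))).differentiableAt
      (by norm_num))
    (fun a ha => (hlip i a (hseg ha)).trans (by
      gcongr
      exact norm_sub_le_of_mem_segment ha))
    (left_mem_segment ℝ d e) (right_mem_segment ℝ d e)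
  refine h2.trans ?_
  gcongr
  rw [dist_eq_norm, lt_div_iff₀ (by positivity)] at heε
  nlinarith [norm_nonneg (e - d)]

theorem BddFam.contDiffOn_succ (n : ℕ) {φ : ι → D → Z} {Ω : Set D} (hΩ : IsOpen Ω)
    (hconv : Convex ℝ Ω) {B : ℝ} (hφ : ∀ i, ContDiffOn ℝ (n + 2) (φ i) Ω)
    (hB : ∀ j, 1 ≤ j → j ≤ n + 2 → ∀ i, ∀ d ∈ Ω, ‖iteratedFDeriv ℝ j (φ i) d‖ ≤ B)
    {N : D → BddFam ι Z} (hN : ∀ d ∈ Ω, ∀ i, N d i = φ i d)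
    (hnext : ∀ N' : D → BddFam ι (D →L[ℝ] Z),
      (∀ d ∈ Ω, ∀ i, N' d i = fderiv ℝ (φ i) d) → ContDiffOn ℝ n N' Ω) :
    ContDiffOn ℝ (n + 1) N Ω := by
  let N' : D → BddFam ι (D →L[ℝ] Z) := fun d => toBddFam fun i => fderiv ℝ (φ i) d
  have hN' : ∀ d ∈ Ω, ∀ i, N' d i = fderiv ℝ (φ i) d := fun d hd i =>
    toBddFam_apply (B := B) (fun i => by
      rw [← norm_iteratedFDeriv_one]; exact hB 1 le_rfl (by omega) i d hd) i
  have hder : ∀ d ∈ Ω, HasFDerivAt N (BddFam.uncurryCLM ι D Z (N' d)) d := fun d hd =>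
    BddFam.hasFDerivAt hΩ hconv (fun i => (hφ i).of_le le_add_self)
      (fun i d hd => hB 2 (by norm_num) (by omega) i d hd) hN hd (hN' d hd)
  rw [contDiffOn_succ_iff_fderiv_of_isOpen hΩ]
  refine ⟨fun d hd => (hder d hd).differentiableAt.differentiableWithinAt, by simp, ?_⟩
  refine ((BddFam.uncurryCLM ι D Z).contDiff.comp_contDiffOn (hnext N' hN')).congr fun d hd => ?_
  exact (hder d hd).fderiv

end Superposition

theorem BddFam.contDiffOn_aux {D : Type u} {ι : Type w} [NormedAddCommGroup D] [NormedSpace ℝ D]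
    {Ω : Set D} (hΩ : IsOpen Ω) (hconv : Convex ℝ Ω) {B : ℝ} (n : ℕ) :
    ∀ {Z : Type max u v} [NormedAddCommGroup Z] [NormedSpace ℝ Z] {φ : ι → D → Z}
    (_ : ∀ i, ContDiffOn ℝ (n + 1) (φ i) Ω)
    (_ : ∀ j, 1 ≤ j → j ≤ n + 1 → ∀ i, ∀ d ∈ Ω, ‖iteratedFDeriv ℝ j (φ i) d‖ ≤ B)
    {N : D → BddFam ι Z} (_ : ∀ d ∈ Ω, ∀ i, N d i = φ i d), ContDiffOn ℝ n N Ω := by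
  induction n with
  | zero =>
    intro Z _ _ φ hφ hB N hN
    refine BddFam.contDiffOn_zero (B := B) hΩ hconv (fun i => (hφ i).differentiableOn (by simp))
      (fun i d hd => ?_) hN
    rw [← norm_iteratedFDeriv_one]
    exact hB 1 le_rfl le_rfl i d hd
  | succ n ih =>
    intro Z _ _ φ hφ hB N hN
    push_cast at hφ ⊢
    have hφ' : ∀ i, ContDiffOn ℝ (n + 2) (φ i) Ω := fun i => by
      have := hφ i
      rwa [add_assoc, one_add_one_eq_two] at this
    refine BddFam.contDiffOn_succ n hΩ hconv hφ' hB hN fun N' hN' => ih (fun i => ?_) ?_ hN'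
    · exact (hφ i).fderiv_of_isOpen hΩ le_rfl
    · intro j h1 h2 i d hd
      rw [norm_iteratedFDeriv_fderiv]
      exact hB (j + 1) (by omega) (by omega) i d hd

/-- A family of `C^{n+1}` maps whose derivatives of orders `1, …, n + 1` are uniformly bounded
is `C^n` as a map into the space of bounded families. -/
theorem BddFam.contDiffOn {D : Type u} {ι : Type w}
    [NormedAddCommGroup D] [NormedSpace ℝ D]
    {Ω : Set D} (hΩ : IsOpen Ω) (hconv : Convex ℝ Ω) {B : ℝ} (n : ℕ)
    {Z : Type v} [NormedAddCommGroup Z] [NormedSpace ℝ Z] {φ : ι → D → Z}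
    (hφ : ∀ i, ContDiffOn ℝ (n + 1) (φ i) Ω)
    (hB : ∀ j, 1 ≤ j → j ≤ n + 1 → ∀ i, ∀ d ∈ Ω, ‖iteratedFDeriv ℝ j (φ i) d‖ ≤ B)
    {N : D → BddFam ι Z} (hN : ∀ d ∈ Ω, ∀ i, N d i = φ i d) : ContDiffOn ℝ n N Ω := by
  cases n with
  | zero =>
    refine BddFam.contDiffOn_zero (B := B) hΩ hconv (fun i => (hφ i).differentiableOn (by simp))
      (fun i d hd => ?_) hN
    rw [← norm_iteratedFDeriv_one]
    exact hB 1 le_rfl le_rfl i d hd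
  | succ n =>
    push_cast at hφ ⊢
    have hφ' : ∀ i, ContDiffOn ℝ (n + 2) (φ i) Ω := fun i => by
      have := hφ i
      rwa [add_assoc, one_add_one_eq_two] at this
    refine BddFam.contDiffOn_succ n hΩ hconv hφ' hB hN fun N' hN' =>
      BddFam.contDiffOn_aux.{u, v} hΩ hconv (B := B) n (fun i => ?_) ?_ hN'
    · exact (hφ i).fderiv_of_isOpen hΩ le_rfl
    · intro j h1 h2 i d hd
      rw [norm_iteratedFDeriv_fderiv]
      exact hB (j + 1) (by omega) (by omega) i d hd

section FixedPoint

variable {E V : Type*} [NormedAddCommGroup E] [NormedSpace ℝ E]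
  [NormedAddCommGroup V] [NormedSpace ℝ V]
  {S : Set E} {O : Set V} {F : E × V → V} {q : ℝ} {z : E → V}

theorem norm_fderiv_comp_inr_le (hO : IsOpen O) (hq0 : 0 ≤ q)
    (hlip : ∀ e ∈ S, ∀ v ∈ O, ∀ w ∈ O, ‖F (e, v) - F (e, w)‖ ≤ q * ‖v - w‖)
    {e : E} {v : V} (he : e ∈ S) (hv : v ∈ O) (hF : DifferentiableAt ℝ F (e, v)) :
    ‖(fderiv ℝ F (e, v)).comp (ContinuousLinearMap.inr ℝ E V)‖ ≤ q := by
  have h1 : HasFDerivAt (fun w : V => (e, w)) (ContinuousLinearMap.inr ℝ E V) v :=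
    hasFDerivAt_prodMk_right e v
  have h2 : HasFDerivAt (fun w => F (e, w))
      ((fderiv ℝ F (e, v)).comp (ContinuousLinearMap.inr ℝ E V)) v :=
    HasFDerivAt.comp v hF.hasFDerivAt h1
  rw [← h2.fderiv]
  refine norm_fderiv_le_of_lip' ℝ hq0 ?_
  filter_upwards [hO.mem_nhds hv] with w hw
  exact hlip e he w hw v hv

open Filter Topology Asymptotics in
theorem hasFDerivAt_of_fixedPoint [CompleteSpace V] (hS : IsOpen S) (hO : IsOpen O)
    (hq0 : 0 ≤ q) (hq1 : q < 1)
    (hlip : ∀ e ∈ S, ∀ v ∈ O, ∀ w ∈ O, ‖F (e, v) - F (e, w)‖ ≤ q * ‖v - w‖)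
    (hzO : ∀ e ∈ S, z e ∈ O) (hz : ∀ e ∈ S, z e = F (e, z e))
    {e : E} (he : e ∈ S) (hF : DifferentiableAt ℝ F (e, z e)) :
    HasFDerivAt z ((Ring.inverse
      (1 - (fderiv ℝ F (e, z e)).comp (ContinuousLinearMap.inr ℝ E V))).comp
        ((fderiv ℝ F (e, z e)).comp (ContinuousLinearMap.inl ℝ E V))) e := by
  set L := fderiv ℝ F (e, z e) with hL
  set b := L.comp (ContinuousLinearMap.inr ℝ E V) with hb
  set a := L.comp (ContinuousLinearMap.inl ℝ E V) with ha
  have hbq : ‖b‖ < 1 := (norm_fderiv_comp_inr_le hO hq0 hlip he (hzO e he) hF).trans_lt hq1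
  have hu : Ring.inverse (1 - b) * (1 - b) = 1 :=
    Ring.inverse_mul_cancel _ (isUnit_one_sub_of_norm_lt_one hbq)
  set R := Ring.inverse (1 - b) with hR
  have hdiff : HasFDerivAt (fun m : E => F (m, z e)) a e :=
    HasFDerivAt.comp e hF.hasFDerivAt (hasFDerivAt_prodMk_left e (z e))
  have hO1 : (fun m => z m - z e) =O[𝓝 e] fun m => m - e := by
    refine IsBigO.trans ?_ hdiff.differentiableAt.isBigO_sub
    refine IsBigO.of_bound (1 - q)⁻¹ ?_
    filter_upwards [hS.mem_nhds he] with m hm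
    rw [inv_mul_eq_div, le_div_iff₀ (by linarith)]
    have h1 : z m - z e = (F (m, z m) - F (m, z e)) + (F (m, z e) - F (e, z e)) := by
      rw [← hz m hm, ← hz e he]; abel
    have h2 := norm_add_le (F (m, z m) - F (m, z e)) (F (m, z e) - F (e, z e))
    rw [← h1] at h2
    have h3 := hlip m hm _ (hzO m hm) _ (hzO e he)
    nlinarith
  have hcont : Tendsto z (𝓝 e) (𝓝 (z e)) := by
    have : Tendsto (fun m => z m - z e) (𝓝 e) (𝓝 0) := by
      refine hO1.trans_tendsto ?_
      have : Tendsto (fun m : E => m - e) (𝓝 e) (𝓝 (e - e)) := tendsto_id.sub_const e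
      simpa using this
    simpa using this.add_const (z e)
  have hpair : Tendsto (fun m => (m, z m)) (𝓝 e) (𝓝 (e, z e)) := by
    rw [nhds_prod_eq]; exact tendsto_id.prodMk hcont
  have hlo : (fun m => F (m, z m) - F (e, z e) - L ((m, z m) - (e, z e))) =o[𝓝 e]
      fun m => m - e := by
    refine (hF.hasFDerivAt.isLittleO.comp_tendsto hpair).trans_isBigO ?_
    exact (isBigO_refl _ _).prod_left hO1
  apply HasFDerivAt.of_isLittleO
  have h3 := (R.isBigO_comp (fun m => F (m, z m) - F (e, z e) - L ((m, z m) - (e, z e)))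
    (𝓝 e)).trans_isLittleO hlo
  refine h3.congr' ?_ (EventuallyEq.refl _ _)
  filter_upwards [hS.mem_nhds he] with m hm
  rw [← hz m hm, ← hz e he]
  have h4 : L ((m, z m) - (e, z e)) = a (m - e) + b (z m - z e) := by
    rw [ha, hb]
    simp [← map_add]
  have h5 : z m - z e - L ((m, z m) - (e, z e)) = (1 - b) (z m - z e) - a (m - e) := by
    rw [h4]; simp; abel
  rw [h5, map_sub, ← mul_apply_eq_comp, hu]
  simp

/-- A fixed point of a uniform contraction of class `C^n` depends `C^n` on the parameter. -/
theorem contDiffOn_of_fixedPoint [CompleteSpace V] (hS : IsOpen S) (hO : IsOpen O)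
    (hq0 : 0 ≤ q) (hq1 : q < 1)
    (hlip : ∀ e ∈ S, ∀ v ∈ O, ∀ w ∈ O, ‖F (e, v) - F (e, w)‖ ≤ q * ‖v - w‖)
    (hzO : ∀ e ∈ S, z e ∈ O) (hz : ∀ e ∈ S, z e = F (e, z e))
    {n : ℕ} (hn : 1 ≤ n) (hF : ContDiffOn ℝ n F (S ×ˢ O)) : ContDiffOn ℝ n z S := by
  have hSO : IsOpen (S ×ˢ O) := hS.prod hO
  have hmem : ∀ e ∈ S, (e, z e) ∈ S ×ˢ O := fun e he => ⟨he, hzO e he⟩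
  have hFd : ∀ e ∈ S, DifferentiableAt ℝ F (e, z e) := fun e he =>
    (hF.contDiffAt (hSO.mem_nhds (hmem e he))).differentiableAt
      (by exact_mod_cast (by omega : n ≠ 0))
  have hder := fun e he => hasFDerivAt_of_fixedPoint hS hO hq0 hq1 hlip hzO hz he (hFd e he)
  have main : ∀ m : ℕ, m ≤ n → ContDiffOn ℝ m z S := by
    intro m
    induction m with
    | zero =>
      intro _
      exact _root_.contDiffOn_zero.2 fun e he => (hder e he).continuousAt.continuousWithinAt
    | succ m ih =>
      intro hm
      have hzm := ih (by omega)
      push_cast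
      rw [contDiffOn_succ_iff_fderiv_of_isOpen hS]
      refine ⟨fun e he => (hder e he).differentiableAt.differentiableWithinAt, by simp, ?_⟩
      have hfd : ContDiffOn ℝ m (fun e => fderiv ℝ F (e, z e)) S :=
        (hF.fderiv_of_isOpen (m := m) hSO (by exact_mod_cast hm)).comp
          (contDiffOn_id.prodMk hzm) hmem
      refine ContDiffOn.congr (f := fun e => (Ring.inverse
        (1 - (fderiv ℝ F (e, z e)).comp (ContinuousLinearMap.inr ℝ E V))).comp
        ((fderiv ℝ F (e, z e)).comp (ContinuousLinearMap.inl ℝ E V))) ?_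
        fun e he => (hder e he).fderiv
      refine ContDiffOn.clm_comp ?_ (hfd.clm_comp contDiffOn_const)
      intro e he
      have hu := isUnit_one_sub_of_norm_lt_one
        ((norm_fderiv_comp_inr_le hO hq0 hlip he (hzO e he) (hFd e he)).trans_lt hq1)
      obtain ⟨u, hu⟩ := hu
      have h1 := contDiffAt_ringInverse ℝ (n := (m : WithTop ℕ∞)) u
      rw [hu] at h1
      exact h1.comp_contDiffWithinAt e
        ((contDiffOn_const.sub (hfd.clm_comp contDiffOn_const)) e he)
  exact main n le_rfl

end FixedPoint

section Evolution

variable {X : Type*} [NormedAddCommGroup X] [NormedSpace ℝ X]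
  {A : ℝ → X →L[ℝ] X} {T : ℝ → ℝ → X →L[ℝ] X}

theorem evolution_comp (hA : Continuous A) (hTid : ∀ s, T s s = 1)
    (hT : ∀ s t, HasDerivAt (fun r => T r s) ((A t).comp (T t s)) t) (t s r : ℝ) :
    T t s * T s r = T t r := by
  obtain ⟨R, hR⟩ : ∃ R, |t| < R ∧ |s| < R :=
    ⟨max |t| |s| + 1, (le_max_left |t| |s|).trans_lt (lt_add_one _),
      (le_max_right |t| |s|).trans_lt (lt_add_one _)⟩
  obtain ⟨K, hK⟩ := (isCompact_Icc (a := -R) (b := R)).exists_bound_of_continuousOn hA.continuousOn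
  have h := ODE_solution_unique_of_mem_Ioo (v := fun t (U : X →L[ℝ] X) => (A t).comp U)
    (s := fun _ => univ) (K := K.toNNReal) (a := -R) (b := R) (t₀ := s)
    (f := fun t => T t s * T s r) (g := fun t => T t r)
    (fun u hu => by
      refine LipschitzOnWith.of_dist_le_mul fun U _ W _ => ?_
      rw [dist_eq_norm, dist_eq_norm, ← ContinuousLinearMap.comp_sub]
      refine (ContinuousLinearMap.opNorm_comp_le _ _).trans ?_
      gcongr
      exact (hK u (Ioo_subset_Icc_self hu)).trans (Real.le_coe_toNNReal K))
    (abs_lt.1 hR.2)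
    (fun u _ => ⟨by
      have := (hT s u).mul_const (T s r)
      exact this, mem_univ _⟩)
    (fun u _ => ⟨hT r u, mem_univ _⟩) (by simp [hTid])
  exact h (abs_lt.1 hR.1)

theorem evolution_hasDerivAt_right [CompleteSpace X] (hA : Continuous A) (hTid : ∀ s, T s s = 1)
    (hT : ∀ s t, HasDerivAt (fun r => T r s) ((A t).comp (T t s)) t) (t s : ℝ) :
    HasDerivAt (fun r => T t r) (-(T t s * A s)) s := by
  have hc := evolution_comp hA hTid hT
  let U : ℝ → (X →L[ℝ] X)ˣ := fun r =>
    ⟨T r t, T t r, by rw [hc, hTid], by rw [hc, hTid]⟩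
  have h1 : (fun r => T t r) = fun r => Ring.inverse (T r t) := by
    funext r
    exact (Ring.inverse_unit (U r)).symm
  have h2 : HasFDerivAt Ring.inverse
      (-((ContinuousLinearMap.mulLeftRight ℝ (X →L[ℝ] X)) (T t s)) (T t s)) (T s t) :=
    hasFDerivAt_ringInverse (𝕜 := ℝ) (U s)
  rw [h1]
  have h3 := h2.comp_hasDerivAt s (hT t s)
  refine h3.congr_deriv ?_
  have h4 : T s t * T t s = 1 := by rw [hc, hTid]
  change -(T t s * (A s * T s t) * T t s) = -(T t s * A s)
  rw [mul_assoc, mul_assoc, h4, mul_one]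

theorem continuous_evolution [CompleteSpace X] (hA : Continuous A) (hTid : ∀ s, T s s = 1)
    (hT : ∀ s t, HasDerivAt (fun r => T r s) ((A t).comp (T t s)) t) :
    Continuous (fun p : ℝ × ℝ => T p.1 p.2) := by
  have h1 : Continuous fun t => T t 0 :=
    continuous_iff_continuousAt.2 fun t => (hT 0 t).continuousAt
  have h2 : Continuous fun s => T 0 s :=
    continuous_iff_continuousAt.2 fun s => (evolution_hasDerivAt_right hA hTid hT 0 s).continuousAt
  refine ((h1.comp continuous_fst).mul (h2.comp continuous_snd)).congr fun p => ?_
  exact evolution_comp hA hTid hT _ _ _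

variable {P : ℝ → X →L[ℝ] X} {G : ℝ → ℝ → X →L[ℝ] X}

theorem stronglyMeasurable_green [CompleteSpace X] (hA : Continuous A) (hTid : ∀ s, T s s = 1)
    (hT : ∀ s t, HasDerivAt (fun r => T r s) ((A t).comp (T t s)) t)
    (hcomm : ∀ t s, (T t s).comp (P s) = (P t).comp (T t s))
    (hG : ∀ t s, G t s = if s ≤ t then (T t s).comp (P s) else -((T t s).comp (1 - P s))) :
    StronglyMeasurable (fun p : ℝ × ℝ => G p.1 p.2) := by
  have hTc := continuous_evolution hA hTid hT
  have hTP : ∀ t s, (T t s).comp (P s) = T t 0 * P 0 * T 0 s := fun t s => by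
    rw [mul_assoc, ← ContinuousLinearMap.mul_def, ← evolution_comp hA hTid hT t 0 s, mul_assoc]
    congr 1
    exact hcomm 0 s
  have h0 : Continuous fun p : ℝ × ℝ => T p.1 0 * P 0 * T 0 p.2 :=
    ((hTc.comp (continuous_fst.prodMk continuous_const)).mul continuous_const).mul
      (hTc.comp (continuous_const.prodMk continuous_snd))
  have hc1 : Continuous fun p : ℝ × ℝ => (T p.1 p.2).comp (P p.2) :=
    h0.congr fun p => (hTP p.1 p.2).symm
  have hc2 : Continuous fun p : ℝ × ℝ => -((T p.1 p.2).comp (1 - P p.2)) := by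
    refine (hTc.sub hc1).neg.congr fun p => ?_
    ext v
    simp
  have : (fun p : ℝ × ℝ => G p.1 p.2) = {p : ℝ × ℝ | p.2 ≤ p.1}.piecewise
      (fun p => (T p.1 p.2).comp (P p.2)) (fun p => -((T p.1 p.2).comp (1 - P p.2))) := by
    funext p
    simp only [hG, Set.piecewise, mem_ofPred_eq]
  rw [this]
  exact hc1.stronglyMeasurable.piecewise (measurableSet_le measurable_snd measurable_fst)
    hc2.stronglyMeasurable

end Evolution

theorem integrable_exp_neg_mul_abs_sub {ρ : ℝ} (hρ : 0 < ρ) (t : ℝ) :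
    Integrable fun s : ℝ => Real.exp (-ρ * |t - s|) := by
  rw [← integrableOn_univ, ← Iic_union_Ioi (a := t), integrableOn_union]
  constructor
  · have h := (integrableOn_exp_mul_Iic hρ t).const_mul (Real.exp (-ρ * t))
    refine IntegrableOn.congr_fun h (fun s hs => ?_) measurableSet_Iic
    rw [← Real.exp_add, abs_of_nonneg (sub_nonneg.2 hs)]
    ring_nf
  · have h := (integrableOn_exp_mul_Ioi (neg_neg_of_pos hρ) t).const_mul (Real.exp (ρ * t))
    refine IntegrableOn.congr_fun h (fun s hs => ?_) measurableSet_Ioi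
    rw [← Real.exp_add, abs_of_neg (sub_neg.2 hs)]
    ring_nf

theorem integral_exp_neg_mul_abs_sub {ρ : ℝ} (hρ : 0 < ρ) (t : ℝ) :
    ∫ s : ℝ, Real.exp (-ρ * |t - s|) = 2 / ρ := by
  have hint := integrable_exp_neg_mul_abs_sub hρ t
  rw [← integral_add_compl measurableSet_Iic hint (s := Iic t), compl_Iic]
  have h1 : ∫ s in Iic t, Real.exp (-ρ * |t - s|) = 1 / ρ := by
    rw [setIntegral_congr_fun (g := fun s => Real.exp (-ρ * t) * Real.exp (ρ * s))
      measurableSet_Iic (fun s hs => ?_), integral_const_mul, integral_exp_mul_Iic hρ,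
      mul_div_assoc', ← Real.exp_add]
    · simp
    · simp only
      rw [← Real.exp_add, abs_of_nonneg (sub_nonneg.2 hs)]
      ring_nf
  have h2 : ∫ s in Ioi t, Real.exp (-ρ * |t - s|) = 1 / ρ := by
    rw [setIntegral_congr_fun (g := fun s => Real.exp (ρ * t) * Real.exp (-ρ * s))
      measurableSet_Ioi (fun s hs => ?_), integral_const_mul,
      integral_exp_mul_Ioi (neg_neg_of_pos hρ), neg_div_neg_eq, mul_div_assoc', ← Real.exp_add]
    · simp
    · simp only
      rw [← Real.exp_add, abs_of_neg (sub_neg.2 hs)]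
      ring_nf
  rw [h1, h2]; ring

section Green

variable {X : Type*} [NormedAddCommGroup X] [NormedSpace ℝ X] {G : ℝ → ℝ → X →L[ℝ] X} {D ρ : ℝ}

theorem norm_green_apply_le (hdich : ∀ t s, ‖G t s‖ ≤ D * Real.exp (-ρ * |t - s|)) {h : ℝ → X}
    {B : ℝ} (hB : ∀ s, ‖h s‖ ≤ B) (t s : ℝ) :
    ‖G t s (h s)‖ ≤ D * Real.exp (-ρ * |t - s|) * B :=
  (G t s).le_of_opNorm_le_of_le (hdich t s) (hB s)

theorem integrable_green (hρ : 0 < ρ) (hdich : ∀ t s, ‖G t s‖ ≤ D * Real.exp (-ρ * |t - s|))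
    (hGm : StronglyMeasurable (fun p : ℝ × ℝ => G p.1 p.2)) {h : ℝ → X}
    (hm : StronglyMeasurable h) {B : ℝ} (hB : ∀ s, ‖h s‖ ≤ B) (t : ℝ) :
    Integrable fun s => G t s (h s) := by
  have h1 : StronglyMeasurable fun s => G t s := hGm.comp_measurable measurable_prodMk_left
  refine Integrable.mono' (((integrable_exp_neg_mul_abs_sub hρ t).const_mul D).mul_const B)
    ?_ (Filter.Eventually.of_forall fun s => norm_green_apply_le hdich hB t s)
  exact (isBoundedBilinearMap_apply.continuous.comp_stronglyMeasurable
    (h1.prodMk hm)).aestronglyMeasurable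

theorem norm_integral_green_le (hρ : 0 < ρ)
    (hdich : ∀ t s, ‖G t s‖ ≤ D * Real.exp (-ρ * |t - s|)) {h : ℝ → X}
    {B : ℝ} (hB : ∀ s, ‖h s‖ ≤ B) (t : ℝ) : ‖∫ s, G t s (h s)‖ ≤ 2 * D / ρ * B := by
  refine (norm_integral_le_of_norm_le
    (((integrable_exp_neg_mul_abs_sub hρ t).const_mul D).mul_const B)
    (Filter.Eventually.of_forall fun s => norm_green_apply_le hdich hB t s)).trans (le_of_eq ?_)
  rw [integral_mul_const, integral_const_mul, integral_exp_neg_mul_abs_sub hρ]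
  ring

theorem stronglyMeasurable_integral_green
    (hGm : StronglyMeasurable (fun p : ℝ × ℝ => G p.1 p.2)) {h : ℝ → X}
    (hm : StronglyMeasurable h) : StronglyMeasurable fun t => ∫ s, G t s (h s) := by
  refine StronglyMeasurable.integral_prod_right (f := fun t s => G t s (h s)) ?_
  exact isBoundedBilinearMap_apply.continuous.comp_stronglyMeasurable
    (hGm.prodMk (hm.comp_measurable measurable_snd))

open Filter Topology in
/-- A bounded solution of `z' = A(t) z + h(t)` with bounded `h` is given by Green's function. -/
theorem eq_integral_green [CompleteSpace X] {A : ℝ → X →L[ℝ] X} {T : ℝ → ℝ → X →L[ℝ] X}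
    {P : ℝ → X →L[ℝ] X} (hA : Continuous A) (hTid : ∀ s, T s s = 1)
    (hT : ∀ s t, HasDerivAt (fun r => T r s) ((A t).comp (T t s)) t)
    (hcomm : ∀ t s, (T t s).comp (P s) = (P t).comp (T t s))
    (hG : ∀ t s, G t s = if s ≤ t then (T t s).comp (P s) else -((T t s).comp (1 - P s)))
    (hρ : 0 < ρ) (hdich : ∀ t s, ‖G t s‖ ≤ D * Real.exp (-ρ * |t - s|))
    {z h : ℝ → X} (hz : ∀ t, HasDerivAt z (A t (z t) + h t) t) {R : ℝ} (hzR : ∀ t, ‖z t‖ ≤ R)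
    (hm : StronglyMeasurable h) {B : ℝ} (hB : ∀ s, ‖h s‖ ≤ B) (t : ℝ) :
    z t = ∫ s, G t s (h s) := by
  have hGm := stronglyMeasurable_green hA hTid hT hcomm hG
  have hint := integrable_green hρ hdich hGm hm hB t
  have hG1 : ∀ s, s ≤ t → ∀ v, G t s v = P t (T t s v) := fun s hs v => by
    rw [hG, if_pos hs, hcomm]; rfl
  have hG2 : ∀ s, t < s → ∀ v, G t s v = -((1 - P t) (T t s v)) := fun s hs v => by
    rw [hG, if_neg hs.not_ge]
    have h1 := congrArg (fun L : X →L[ℝ] X => L v) (hcomm t s)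
    simp only [ContinuousLinearMap.comp_apply] at h1
    simp [h1]
  have hder : ∀ s, HasDerivAt (fun s => T t s (z s)) (T t s (h s)) s := fun s => by
    have := (evolution_hasDerivAt_right hA hTid hT t s).clm_apply (hz s)
    convert this using 1
    simp
  have htend : ∀ l : Filter ℝ, Tendsto (fun s => |t - s|) l atTop →
      Tendsto (fun s => G t s (z s)) l (𝓝 0) := fun l hl => by
    refine squeeze_zero_norm (fun s => norm_green_apply_le hdich hzR t s) ?_
    have h1 : Tendsto (fun s => Real.exp (-ρ * |t - s|)) l (𝓝 0) :=
      Real.tendsto_exp_atBot.comp (hl.const_mul_atTop_of_neg (neg_neg_of_pos hρ))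
    simpa using (h1.const_mul D).mul_const R
  have hbot : Tendsto (fun s => |t - s|) atBot atTop :=
    tendsto_abs_atTop_atTop.comp (tendsto_atTop_add_const_left _ t tendsto_neg_atBot_atTop)
  have htop : Tendsto (fun s => |t - s|) atTop atTop :=
    tendsto_abs_atBot_atTop.comp (tendsto_atBot_add_const_left _ t tendsto_neg_atTop_atBot)
  rw [← integral_add_compl measurableSet_Iic hint (s := Iic t), compl_Iic]
  have hd1 : ∀ s, HasDerivAt (fun s => P t (T t s (z s))) (P t (T t s (h s))) s := fun s =>
    (P t).hasFDerivAt.comp_hasDerivAt s (hder s)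
  have hd2 : ∀ s, HasDerivAt (fun s => -((1 - P t) (T t s (z s))))
      (-((1 - P t) (T t s (h s)))) s := fun s =>
    ((1 - P t).hasFDerivAt.comp_hasDerivAt s (hder s)).neg
  have h1 : ∫ s in Iic t, G t s (h s) = P t (z t) := by
    rw [setIntegral_congr_fun measurableSet_Iic fun s hs => hG1 s hs (h s),
      integral_Iic_of_hasDerivAt_of_tendsto (hd1 t).continuousAt.continuousWithinAt
        (fun s _ => hd1 s) (m := 0)]
    · simp [hTid]
    · exact hint.integrableOn.congr_fun (fun s hs => hG1 s hs (h s)) measurableSet_Iic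
    · refine (htend _ hbot).congr' ?_
      filter_upwards [Iic_mem_atBot t] with s hs
      exact hG1 s hs _
  have h2 : ∫ s in Ioi t, G t s (h s) = z t - P t (z t) := by
    rw [setIntegral_congr_fun measurableSet_Ioi fun s hs => hG2 s hs (h s),
      integral_Ioi_of_hasDerivAt_of_tendsto (hd2 t).continuousAt.continuousWithinAt
        (fun s _ => hd2 s) (m := 0)]
    · simp [hTid]
    · exact hint.integrableOn.congr_fun (fun s hs => hG2 s hs (h s)) measurableSet_Ioi
    · refine (htend _ htop).congr' ?_
      filter_upwards [Ioi_mem_atTop t] with s hs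
      exact hG2 s hs _
  rw [h1, h2]; abel

end Green

/-- The bounded strongly measurable functions on the line, as a subspace of all bounded ones. -/
def measFam (X : Type*) [NormedAddCommGroup X] [NormedSpace ℝ X] :
    Submodule ℝ (BddFam ℝ X) where
  carrier := {v | StronglyMeasurable fun s => v s}
  add_mem' := fun ha hb => StronglyMeasurable.add ha hb
  zero_mem' := stronglyMeasurable_zero
  smul_mem' := fun c _ ha => StronglyMeasurable.const_smul ha c

theorem isClosed_measFam (X : Type*) [NormedAddCommGroup X] [NormedSpace ℝ X] :
    IsClosed (measFam X : Set (BddFam ℝ X)) := by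
  refine IsSeqClosed.isClosed fun v w hv hvw => ?_
  refine stronglyMeasurable_of_tendsto Filter.atTop (f := fun n s => v n s) hv ?_
  rw [tendsto_pi_nhds]
  intro s
  exact ((lp.evalCLM ℝ (fun _ : ℝ => X) ⊤ s).continuous.tendsto w).comp hvw

instance (X : Type*) [NormedAddCommGroup X] [NormedSpace ℝ X] [CompleteSpace X] :
    CompleteSpace (measFam X) :=
  (isClosed_measFam X).completeSpace_coe

theorem exists_greenCLM {X : Type*} [NormedAddCommGroup X] [NormedSpace ℝ X]
    {G : ℝ → ℝ → X →L[ℝ] X} {D ρ : ℝ} (hD : 0 < D) (hρ : 0 < ρ)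
    (hdich : ∀ t s, ‖G t s‖ ≤ D * Real.exp (-ρ * |t - s|))
    (hGm : StronglyMeasurable (fun p : ℝ × ℝ => G p.1 p.2)) :
    ∃ K : measFam X →L[ℝ] measFam X, ‖K‖ ≤ 2 * D / ρ ∧
      ∀ (v : measFam X) (t : ℝ), (K v : BddFam ℝ X) t = ∫ s, G t s ((v : BddFam ℝ X) s) := by
  have hi : ∀ (v : measFam X) t, Integrable fun s => G t s ((v : BddFam ℝ X) s) := fun v t =>
    integrable_green hρ hdich hGm v.2 (BddFam.norm_apply_le (v : BddFam ℝ X)) t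
  have hb : ∀ (v : measFam X) t, ‖∫ s, G t s ((v : BddFam ℝ X) s)‖ ≤ 2 * D / ρ * ‖v‖ := fun v t =>
    norm_integral_green_le hρ hdich (BddFam.norm_apply_le (v : BddFam ℝ X)) t
  let K0 : measFam X →ₗ[ℝ] measFam X :=
    { toFun := fun v => ⟨⟨fun t => ∫ s, G t s ((v : BddFam ℝ X) s),
        memℓp_infty ⟨_, by rintro _ ⟨t, rfl⟩; exact hb v t⟩⟩,
        stronglyMeasurable_integral_green hGm v.2⟩
      map_add' := fun v w => by
        ext t
        simp only [Submodule.coe_add, lp.coeFn_add, Pi.add_apply, map_add]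
        exact integral_add (hi v t) (hi w t)
      map_smul' := fun c v => by
        ext t
        simp only [Submodule.coe_smul, lp.coeFn_smul, Pi.smul_apply, map_smul]
        exact integral_smul c _ }
  refine ⟨K0.mkContinuous (2 * D / ρ) fun v => ?_, LinearMap.mkContinuous_norm_le _ (by positivity) _,
    fun v t => rfl⟩
  exact lp.norm_le_of_forall_le (f := (K0 v : BddFam ℝ X)) (by positivity) (hb v)

theorem norm_iteratedFDeriv_comp_right_le {W W' Z : Type*} [NormedAddCommGroup W]
    [NormedSpace ℝ W] [NormedAddCommGroup W'] [NormedSpace ℝ W'] [NormedAddCommGroup Z]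
    [NormedSpace ℝ Z] {F : W' → Z} {U : Set W'} (hU : IsOpen U) {n : WithTop ℕ∞}
    (hF : ContDiffOn ℝ n F U)
    (L : W →L[ℝ] W') {w : W} (hw : L w ∈ U) {i : ℕ} (hi : i ≤ n) :
    ‖iteratedFDeriv ℝ i (fun w => F (L w)) w‖ ≤ ‖iteratedFDeriv ℝ i F (L w)‖ * ‖L‖ ^ i := by
  have hU' : IsOpen (L ⁻¹' U) := hU.preimage L.continuous
  have h := L.iteratedFDerivWithin_comp_right hF hU.uniqueDiffOn hU'.uniqueDiffOn hw hi
  rw [iteratedFDerivWithin_of_isOpen i hU' hw, iteratedFDerivWithin_of_isOpen i hU hw] at h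
  change ‖iteratedFDeriv ℝ i (F ∘ L) w‖ ≤ _
  rw [h]
  refine (ContinuousMultilinearMap.norm_compContinuousLinearMap_le _ _).trans ?_
  simp

theorem norm_iteratedFDeriv_increment_le {E X Y : Type*} [NormedAddCommGroup E] [NormedSpace ℝ E]
    [NormedAddCommGroup X] [NormedSpace ℝ X] [NormedAddCommGroup Y] [NormedSpace ℝ Y]
    {F : E × X → X} {S : Set E} (hS : IsOpen S) {n : ℕ} (hn : 1 ≤ n)
    (hF : ContDiffOn ℝ (n + 1) F (S ×ˢ univ)) {c C R : ℝ} (hc : 0 ≤ c) (hC : 0 ≤ C) (hR : 0 ≤ R)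
    (hlip : ∀ e ∈ S, ∀ v w, ‖F (e, v) - F (e, w)‖ ≤ c * ‖v - w‖)
    (hbound : ∀ i, 2 ≤ i → i ≤ n + 1 → ∀ p ∈ S ×ˢ (univ : Set X), ‖iteratedFDeriv ℝ i F p‖ ≤ C)
    (ev : Y →L[ℝ] X) (hev : ‖ev‖ ≤ 1) {i : ℕ} (hi1 : 1 ≤ i) (hin : i ≤ n + 1)
    {d : E × Y × Y} (hdS : d.1 ∈ S) (hdR : ‖d.2.2‖ ≤ R) :
    ‖iteratedFDeriv ℝ i (fun d : E × Y × Y =>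
      F (d.1, ev d.2.1 + ev d.2.2) - F (d.1, ev d.2.1)) d‖ ≤
        C * R * 2 + c + (C * 2 ^ (n + 1) + C) := by
  set U : Set (E × X) := S ×ˢ univ with hUdef
  have hU : IsOpen U := hS.prod isOpen_univ
  let p1 : E × Y × Y →L[ℝ] E := ContinuousLinearMap.fst ℝ E (Y × Y)
  let p2 : E × Y × Y →L[ℝ] Y :=
    (ContinuousLinearMap.fst ℝ Y Y).comp (ContinuousLinearMap.snd ℝ E (Y × Y))
  let p3 : E × Y × Y →L[ℝ] Y :=
    (ContinuousLinearMap.snd ℝ Y Y).comp (ContinuousLinearMap.snd ℝ E (Y × Y))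
  let e1 : E × Y × Y →L[ℝ] E × X := p1.prod (ev.comp p2 + ev.comp p3)
  let e2 : E × Y × Y →L[ℝ] E × X := p1.prod (ev.comp p2)
  have hev' : ∀ y, ‖ev y‖ ≤ ‖y‖ := fun y => by simpa using ev.le_of_opNorm_le hev y
  have hn1 : ∀ d : E × Y × Y, ‖d.1‖ ≤ ‖d‖ := fun d => norm_fst_le d
  have hn2 : ∀ d : E × Y × Y, ‖d.2.1‖ ≤ ‖d‖ := fun d => (norm_fst_le d.2).trans (norm_snd_le d)
  have hn3 : ∀ d : E × Y × Y, ‖d.2.2‖ ≤ ‖d‖ := fun d => (norm_snd_le d.2).trans (norm_snd_le d)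
  have he1 : ‖e1‖ ≤ 2 := ContinuousLinearMap.opNorm_le_bound _ (by norm_num) fun d => by
    refine max_le ?_ ?_
    · change ‖d.1‖ ≤ _
      linarith [hn1 d, norm_nonneg d]
    · change ‖ev d.2.1 + ev d.2.2‖ ≤ _
      linarith [norm_add_le (ev d.2.1) (ev d.2.2), hev' d.2.1, hev' d.2.2, hn2 d, hn3 d]
  have he2 : ‖e2‖ ≤ 1 := ContinuousLinearMap.opNorm_le_bound _ (by norm_num) fun d => by
    rw [one_mul]
    exact max_le (hn1 d) ((hev' d.2.1).trans (hn2 d))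
  have hm1 : e1 d ∈ U := ⟨hdS, mem_univ _⟩
  have hm2 : e2 d ∈ U := ⟨hdS, mem_univ _⟩
  have hc1 : ContDiffAt ℝ (n + 1) (fun d => F (e1 d)) d :=
    (hF.contDiffAt (hU.mem_nhds hm1)).comp d e1.contDiff.contDiffAt
  have hc2 : ContDiffAt ℝ (n + 1) (fun d => F (e2 d)) d :=
    (hF.contDiffAt (hU.mem_nhds hm2)).comp d e2.contDiff.contDiffAt
  have hile : ((i : ℕ) : WithTop ℕ∞) ≤ (n + 1) := by exact_mod_cast hin
  change ‖iteratedFDeriv ℝ i ((fun d => F (e1 d)) - (fun d => F (e2 d))) d‖ ≤ _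
  rcases Nat.lt_or_ge i 2 with h2 | h2
  · obtain rfl : i = 1 := by omega
    have hFd : ∀ p ∈ U, DifferentiableAt ℝ F p := fun p hp =>
      (hF.contDiffAt (hU.mem_nhds hp)).differentiableAt (by simp)
    have hd1 : HasFDerivAt (fun d => F (e1 d)) ((fderiv ℝ F (e1 d)).comp e1) d :=
      (hFd _ hm1).hasFDerivAt.comp d e1.hasFDerivAt
    have hd2 : HasFDerivAt (fun d => F (e2 d)) ((fderiv ℝ F (e2 d)).comp e2) d :=
      (hFd _ hm2).hasFDerivAt.comp d e2.hasFDerivAt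
    rw [norm_iteratedFDeriv_one, (hd1.sub hd2).fderiv]
    have hsplit : (fderiv ℝ F (e1 d)).comp e1 - (fderiv ℝ F (e2 d)).comp e2
        = (fderiv ℝ F (e1 d) - fderiv ℝ F (e2 d)).comp e1
          + ((fderiv ℝ F (e2 d)).comp (ContinuousLinearMap.inr ℝ E X)).comp (ev.comp p3) := by
      have : e1 = e2 + (ContinuousLinearMap.inr ℝ E X).comp (ev.comp p3) := by
        ext x <;> simp [e1, e2]
      have key : ∀ M : E × X →L[ℝ] X, M.comp e1
          = M.comp e2 + (M.comp (ContinuousLinearMap.inr ℝ E X)).comp (ev.comp p3) := by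
        intro M
        rw [this, ContinuousLinearMap.comp_add, ContinuousLinearMap.comp_assoc]
      rw [ContinuousLinearMap.sub_comp, key (fderiv ℝ F (e2 d))]
      abel
    rw [hsplit]
    have hA : ‖fderiv ℝ F (e1 d) - fderiv ℝ F (e2 d)‖ ≤ C * R := by
      have hseg : segment ℝ (e2 d) (e1 d) ⊆ U := by
        rintro p ⟨a, b, -, -, hab, rfl⟩
        refine ⟨?_, mem_univ _⟩
        change a • d.1 + b • d.1 ∈ S
        rwa [← add_smul, hab, one_smul]
      have h := (convex_segment (𝕜 := ℝ) (e2 d) (e1 d)).norm_image_sub_le_of_norm_fderiv_le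
        (𝕜 := ℝ) (f := fderiv ℝ F) (C := C)
        (fun a ha => (((hF.fderiv_of_isOpen (m := 1) hU (by
          gcongr; exact_mod_cast hn)).contDiffAt
          (hU.mem_nhds (hseg ha))).differentiableAt (by simp)))
        (fun a ha => by
          rw [← norm_iteratedFDeriv_one, norm_iteratedFDeriv_fderiv]
          exact hbound 2 le_rfl (by omega) a (hseg ha))
        (left_mem_segment ℝ _ _) (right_mem_segment ℝ _ _)
      refine h.trans ?_
      gcongr
      have : e1 d - e2 d = (0, ev d.2.2) := by
        simp [e1, e2, p1, p2, p3]
      rw [this, Prod.norm_mk, norm_zero]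
      exact max_le hR ((hev' _).trans hdR)
    have hB : ‖(fderiv ℝ F (e2 d)).comp (ContinuousLinearMap.inr ℝ E X)‖ ≤ c :=
      norm_fderiv_comp_inr_le (S := S) (O := univ) isOpen_univ hc
        (fun e he v _ w _ => hlip e he v w) hdS (mem_univ _) (hFd _ hm2)
    have hp3 : ‖ev.comp p3‖ ≤ 1 := ContinuousLinearMap.opNorm_le_bound _ (by norm_num) fun d => by
      rw [one_mul]
      exact (hev' d.2.2).trans (hn3 d)
    calc _ ≤ ‖(fderiv ℝ F (e1 d) - fderiv ℝ F (e2 d)).comp e1‖ + _ := norm_add_le _ _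
      _ ≤ C * R * 2 + c * 1 := by
        gcongr
        · refine (ContinuousLinearMap.opNorm_comp_le _ _).trans ?_
          gcongr
        · refine (ContinuousLinearMap.opNorm_comp_le _ _).trans ?_
          gcongr
      _ ≤ _ := by
        have : 0 ≤ C * 2 ^ (n + 1) + C := by positivity
        linarith
  · rw [iteratedFDeriv_sub_apply (hc1.of_le hile) (hc2.of_le hile)]
    have hb1 := norm_iteratedFDeriv_comp_right_le hU hF e1 hm1 hile
    have hb2 := norm_iteratedFDeriv_comp_right_le hU hF e2 hm2 hile
    calc _ ≤ ‖iteratedFDeriv ℝ i (fun d => F (e1 d)) d‖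
            + ‖iteratedFDeriv ℝ i (fun d => F (e2 d)) d‖ := norm_sub_le _ _
      _ ≤ C * 2 ^ (n + 1) + C * 1 := by
        gcongr
        · refine hb1.trans ?_
          gcongr
          · exact hbound i h2 hin _ hm1
          · exact (pow_le_pow_left₀ (norm_nonneg _) he1 i).trans
              (pow_le_pow_right₀ (by norm_num) hin)
        · refine hb2.trans ?_
          gcongr
          · exact hbound i h2 hin _ hm2
          · exact pow_le_one₀ (norm_nonneg _) he2
      _ ≤ _ := by
        have : 0 ≤ C * R * 2 + c := by positivity
        linarith

section Shadowing

variable {X : Type v} [NormedAddCommGroup X] [NormedSpace ℝ X]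
  {E : Type u} [NormedAddCommGroup E] [NormedSpace ℝ E]

theorem contDiffOn_toBddFam_increment {Sg Ω : Set E} (hSg : IsOpen Sg) {f : E → ℝ → X → X}
    {k : ℕ} (hk : 1 ≤ k) {c C R : ℝ} (hc : 0 ≤ c) (hC : 0 ≤ C) (hR : 0 ≤ R)
    (hlip : ∀ e ∈ Sg, ∀ t v w, ‖f e t v - f e t w‖ ≤ c * ‖v - w‖)
    (hfC : ∀ t, ContDiffOn ℝ (k + 1) (fun p : E × X => f p.1 t p.2) (Sg ×ˢ univ))
    (hfbound : ∀ i, 2 ≤ i → i ≤ k + 1 → ∀ t, ∀ e ∈ Sg, ∀ ξ,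
      ‖iteratedFDerivWithin ℝ i (fun p : E × X => f p.1 t p.2) (Sg ×ˢ univ) (e, ξ)‖ ≤ C)
    (hΩ : IsOpen Ω) (hconv : Convex ℝ Ω) (hΩS : Ω ⊆ Sg) (a : ℝ → X) :
    ContDiffOn ℝ k (fun d : E × BddFam ℝ X × BddFam ℝ X => toBddFam fun s =>
      f d.1 s (d.2.1 s + d.2.2 s + a s) - f d.1 s (d.2.1 s + a s))
      (Ω ×ˢ (univ ×ˢ Metric.ball 0 R)) := by
  have hU : IsOpen (Sg ×ˢ (univ : Set X)) := hSg.prod isOpen_univ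
  let F : ℝ → E × X → X := fun s p => f p.1 s (p.2 + a s)
  let ev : ℝ → BddFam ℝ X →L[ℝ] X := fun s => lp.evalCLM ℝ (fun _ : ℝ => X) ⊤ s
  have hev : ∀ s, ‖ev s‖ ≤ 1 := fun s =>
    ContinuousLinearMap.opNorm_le_bound _ zero_le_one fun v => by
      rw [one_mul]; exact BddFam.norm_apply_le v s
  have hF : ∀ s, ContDiffOn ℝ (k + 1) (F s) (Sg ×ˢ univ) := fun s =>
    (hfC s).comp (g := fun p : E × X => f p.1 s p.2) (f := fun p : E × X => (p.1, p.2 + a s))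
      (by fun_prop) (fun p hp => ⟨hp.1, mem_univ _⟩)
  have hFb : ∀ s i, 2 ≤ i → i ≤ k + 1 → ∀ p ∈ Sg ×ˢ (univ : Set X),
      ‖iteratedFDeriv ℝ i (F s) p‖ ≤ C := by
    intro s i h2 hi p hp
    have h1 : F s = fun p => (fun p : E × X => f p.1 s p.2) (p + (0, a s)) := by
      funext p; simp [F]
    have hmem : p + (0, a s) ∈ Sg ×ˢ (univ : Set X) := ⟨by simpa using hp.1, mem_univ _⟩
    rw [h1, iteratedFDeriv_comp_add_right i (f := fun p : E × X => f p.1 s p.2) (0, a s) p,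
      ← iteratedFDerivWithin_of_isOpen i hU hmem]
    exact hfbound i h2 hi s _ hmem.1 _
  refine BddFam.contDiffOn (φ := fun s d => F s (d.1, ev s d.2.1 + ev s d.2.2)
    - F s (d.1, ev s d.2.1)) (hΩ.prod (isOpen_univ.prod Metric.isOpen_ball))
    (hconv.prod (convex_univ.prod (convex_ball 0 R))) k (fun s => ?_)
    (B := C * R * 2 + c + (C * 2 ^ (k + 1) + C)) (fun j h1 hj s d hd => ?_) (fun d hd s => ?_)
  · refine ((hF s).comp (f := fun d : E × BddFam ℝ X × BddFam ℝ X =>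
      (d.1, ev s d.2.1 + ev s d.2.2)) (ContDiff.contDiffOn (by fun_prop))
      fun d hd => ⟨hΩS hd.1, mem_univ _⟩).sub
      ((hF s).comp (f := fun d : E × BddFam ℝ X × BddFam ℝ X =>
      (d.1, ev s d.2.1)) (ContDiff.contDiffOn (by fun_prop)) fun d hd => ⟨hΩS hd.1, mem_univ _⟩)
  · exact norm_iteratedFDeriv_increment_le hSg hk (hF s) hc hC hR
      (fun e he v w => (hlip e he s _ _).trans_eq (by rw [add_sub_add_right_eq_sub])) (hFb s)
      (ev s) (hev s) h1 hj (hΩS hd.1) (mem_ball_zero_iff.1 hd.2.2).le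
  · refine toBddFam_apply (B := c * R) (fun s => ?_) s
    refine (hlip _ (hΩS hd.1) s _ _).trans ?_
    gcongr
    rw [add_sub_add_right_eq_sub, add_sub_cancel_left]
    exact (BddFam.norm_apply_le _ s).trans (mem_ball_zero_iff.1 hd.2.2).le

theorem contDiffOn_toBddFam {Sg Ω : Set E} (hSg : IsOpen Sg) (hΩ : IsOpen Ω)
    (hconv : Convex ℝ Ω) (hΩS : Ω ⊆ Sg) {k : ℕ} {φ : ℝ → E → X} {B B' : ℝ}
    (hφ : ∀ s, ContDiffOn ℝ (k + 1) (φ s) Sg)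
    (hB : ∀ j, 1 ≤ j → j ≤ k + 1 → ∀ s, ∀ e ∈ Ω, ‖iteratedFDerivWithin ℝ j (φ s) Sg e‖ ≤ B)
    (hB' : ∀ e ∈ Ω, ∀ s, ‖φ s e‖ ≤ B') :
    ContDiffOn ℝ k (fun e => toBddFam fun s => φ s e) Ω := by
  refine BddFam.contDiffOn hΩ hconv k (fun s => (hφ s).mono hΩS) (B := B) (fun j h1 hj s e he => ?_)
    fun e he s => toBddFam_apply (hB' e he) s
  rw [← iteratedFDerivWithin_of_isOpen j hSg (hΩS he)]
  exact hB j h1 hj s e he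

open Classical in
/-- Smooth dependence of the fixed points of `K ∘ H`, where `H` preserves measurability. -/
theorem contDiffOn_of_fixedPoint_measFam [CompleteSpace X] {Ω : Set E} (hΩ : IsOpen Ω)
    {H : E × BddFam ℝ X → BddFam ℝ X} {k : ℕ} (hk : 1 ≤ k) {R c κ : ℝ} (hc : 0 ≤ c) (hκ : 0 ≤ κ)
    (hκc : κ * c < 1) (hH : ContDiffOn ℝ k H (Ω ×ˢ Metric.ball 0 R))
    (hHm : ∀ e ∈ Ω, ∀ v ∈ measFam X, ‖v‖ < R → H (e, v) ∈ measFam X)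
    (hlip : ∀ e ∈ Ω, ∀ v w : BddFam ℝ X, ‖v‖ < R → ‖w‖ < R →
      ‖H (e, v) - H (e, w)‖ ≤ c * ‖v - w‖)
    {K : measFam X →L[ℝ] measFam X} (hK : ‖K‖ ≤ κ) {z : E → measFam X}
    (hzR : ∀ e ∈ Ω, ‖z e‖ < R)
    (hz : ∀ e ∈ Ω, ∀ u : measFam X, (u : BddFam ℝ X) = H (e, z e) → z e = K u) :
    ContDiffOn ℝ k z Ω := by
  let Hm : E × measFam X → measFam X := fun p =>
    if h : H (p.1, p.2) ∈ measFam X then ⟨H (p.1, p.2), h⟩ else 0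
  have hHme : ∀ e ∈ Ω, ∀ v : measFam X, ‖v‖ < R → (Hm (e, v) : BddFam ℝ X) = H (e, v) :=
    fun e he v hv => by
      have : H (e, v) ∈ measFam X := hHm e he v v.2 hv
      simp [Hm, this]
  have hO : IsOpen (Ω ×ˢ Metric.ball (0 : measFam X) R) := hΩ.prod Metric.isOpen_ball
  have hHmC : ContDiffOn ℝ k Hm (Ω ×ˢ Metric.ball (0 : measFam X) R) := by
    refine LinearIsometry.contDiffOn_of_comp hO k (measFam X).subtypeₗᵢ ?_
    refine (hH.comp (f := fun p : E × measFam X => (p.1, (measFam X).subtypeL p.2))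
      (ContDiff.contDiffOn (by fun_prop)) fun p hp => ⟨hp.1, by simpa using hp.2⟩).congr ?_
    intro p hp
    exact hHme p.1 hp.1 p.2 (by simpa using hp.2)
  refine contDiffOn_of_fixedPoint (F := fun p => K (Hm p)) (q := κ * c)
    (O := Metric.ball (0 : measFam X) R) hΩ Metric.isOpen_ball (by positivity) hκc
    (fun e he v hv w hw => ?_) (fun e he => by simpa using hzR e he) (fun e he => ?_)
    (by exact_mod_cast hk) (K.contDiff.comp_contDiffOn hHmC)
  · have hv' : ‖v‖ < R := by simpa using hv
    have hw' : ‖w‖ < R := by simpa using hw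
    rw [← map_sub, mul_assoc]
    refine K.le_of_opNorm_le_of_le hK ?_
    change ‖((Hm (e, v) : BddFam ℝ X) - Hm (e, w))‖ ≤ _
    rw [hHme e he v hv', hHme e he w hw']
    exact hlip e he v w hv' hw'
  · exact hz e he _ (hHme e he _ (hzR e he))

end Shadowing

theorem stronglyMeasurable_defect {X : Type*} [NormedAddCommGroup X] [NormedSpace ℝ X]
    [CompleteSpace X] {A : ℝ → X →L[ℝ] X} (hA : Continuous A) {y y' : ℝ → X}
    (hy : ∀ t, HasDerivAt y (y' t) t) : StronglyMeasurable fun s => y' s - A s (y s) := by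
  have hyc : Continuous y := continuous_iff_continuousAt.2 fun t => (hy t).continuousAt
  have hy' : StronglyMeasurable y' := by
    rw [show y' = deriv y from funext fun t => (hy t).deriv.symm]
    exact stronglyMeasurable_deriv y
  exact hy'.sub (hA.clm_apply hyc).stronglyMeasurable

theorem stronglyMeasurable_superposition {X : Type*} [NormedAddCommGroup X] {g : ℝ → X → X}
    (hg : Continuous fun p : ℝ × X => g p.1 p.2) {v : ℝ → X} (hv : StronglyMeasurable v) :
    StronglyMeasurable fun s => g s (v s) :=
  hg.comp_stronglyMeasurable (stronglyMeasurable_id.prodMk hv)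

theorem norm_sub_defect_le {X : Type*} [NormedAddCommGroup X] [NormedSpace ℝ X]
    {A : ℝ → X →L[ℝ] X} {g : ℝ → X → X} {c : ℝ}
    (hlip : ∀ t v w, ‖g t v - g t w‖ ≤ c * ‖v - w‖) {y y' : ℝ → X} {eps : ℝ}
    (hpse : ∀ t, ‖y' t - A t (y t) - g t (y t)‖ ≤ eps) (t : ℝ) (v : X) :
    ‖g t v - (y' t - A t (y t))‖ ≤ c * ‖v - y t‖ + eps := by
  have h : g t v - (y' t - A t (y t))
      = (g t v - g t (y t)) - (y' t - A t (y t) - g t (y t)) := by abel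
  rw [h]
  exact (norm_sub_le _ _).trans (add_le_add (hlip t _ _) (hpse t))

theorem sub_eq_integral_green {X : Type*} [NormedAddCommGroup X] [NormedSpace ℝ X]
    [CompleteSpace X] {A : ℝ → X →L[ℝ] X} {T : ℝ → ℝ → X →L[ℝ] X}
    {P : ℝ → X →L[ℝ] X} {G : ℝ → ℝ → X →L[ℝ] X} {D ρ : ℝ}
    (hA : Continuous A) (hTid : ∀ s, T s s = 1)
    (hT : ∀ s t, HasDerivAt (fun r => T r s) ((A t).comp (T t s)) t)
    (hcomm : ∀ t s, (T t s).comp (P s) = (P t).comp (T t s))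
    (hG : ∀ t s, G t s = if s ≤ t then (T t s).comp (P s) else -((T t s).comp (1 - P s)))
    (hρ : 0 < ρ) (hdich : ∀ t s, ‖G t s‖ ≤ D * Real.exp (-ρ * |t - s|))
    {g : ℝ → X → X} (hg : Continuous fun p : ℝ × X => g p.1 p.2) {c : ℝ} (hc : 0 ≤ c)
    (hlip : ∀ t v w, ‖g t v - g t w‖ ≤ c * ‖v - w‖) {x y y' : ℝ → X} {eps R : ℝ}
    (hy : ∀ t, HasDerivAt y (y' t) t)
    (hpse : ∀ t, ‖y' t - A t (y t) - g t (y t)‖ ≤ eps)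
    (hx : ∀ t, HasDerivAt x (A t (x t) + g t (x t)) t) (hR : ∀ t, ‖x t - y t‖ ≤ R) (t : ℝ) :
    x t - y t = ∫ s, G t s (g s (x s) - (y' s - A s (y s))) := by
  have hxc : Continuous x := continuous_iff_continuousAt.2 fun t => (hx t).continuousAt
  refine eq_integral_green (z := fun t => x t - y t)
    (h := fun s => g s (x s) - (y' s - A s (y s))) (B := c * R + eps) hA hTid hT hcomm hG hρ hdich
    (fun t => ?_) hR ((stronglyMeasurable_superposition hg hxc.stronglyMeasurable).sub
      (stronglyMeasurable_defect hA hy)) (fun s => ?_) t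
  · refine ((hx t).sub (hy t)).congr_deriv ?_
    rw [map_sub]
    abel
  · refine (norm_sub_defect_le hlip hpse s (x s)).trans ?_
    gcongr
    exact hR s

section SmoothDependence

variable {X : Type v} [NormedAddCommGroup X] [NormedSpace ℝ X]
  {E : Type u} [NormedAddCommGroup E] [NormedSpace ℝ E]

theorem contDiffOn_toBddFam_residual {A : ℝ → X →L[ℝ] X} {Sg Ω : Set E} (hSg : IsOpen Sg)
    (hΩ : IsOpen Ω) (hconv : Convex ℝ Ω) (hΩS : Ω ⊆ Sg) {f : E → ℝ → X → X} {y y' : E → ℝ → X}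
    {k : ℕ} {C eps : ℝ}
    (hpse : ∀ e ∈ Sg, ∀ t, ‖y' e t - A t (y e t) - f e t (y e t)‖ ≤ eps)
    (hfC : ∀ t, ContDiffOn ℝ (k + 1) (fun p : E × X => f p.1 t p.2) (Sg ×ˢ univ))
    (hyC : ∀ t, ContDiffOn ℝ (k + 1) (fun e => y e t) Sg)
    (hy'C : ∀ t, ContDiffOn ℝ (k + 1) (fun e => y' e t) Sg)
    (hres : ∀ i : ℕ, 1 ≤ i → i ≤ k + 1 → ∀ t, ∀ e ∈ Sg,
      ‖iteratedFDerivWithin ℝ i (fun m => y' m t) Sg e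
        - (A t).compContinuousMultilinearMap (iteratedFDerivWithin ℝ i (fun m => y m t) Sg e)
        - iteratedFDerivWithin ℝ i (fun m => f m t (y m t)) Sg e‖ ≤ C) :
    ContDiffOn ℝ k (fun e => toBddFam fun s => y' e s - A s (y e s) - f e s (y e s)) Ω := by
  have hAy : ∀ s, ContDiffOn ℝ (k + 1) (A s ∘ fun e => y e s) Sg := fun s =>
    (A s).contDiff.comp_contDiffOn (hyC s)
  have hfy : ∀ s, ContDiffOn ℝ (k + 1) (fun e => f e s (y e s)) Sg := fun s =>
    (hfC s).comp (f := fun e => (e, y e s)) (contDiffOn_id.prodMk (hyC s))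
      fun e he => ⟨he, mem_univ _⟩
  refine contDiffOn_toBddFam hSg hΩ hconv hΩS (B := C) (B' := eps)
    (φ := fun s => (fun e => y' e s) - (A s ∘ fun e => y e s) - fun e => f e s (y e s))
    (fun s => ((hy'C s).sub (hAy s)).sub (hfy s)) (fun j h1 hj s e he => ?_)
    (fun e he s => hpse e (hΩS he) s)
  have heS := hΩS he
  have hle : (j : WithTop ℕ∞) ≤ k + 1 := by exact_mod_cast hj
  have hd : ContDiffOn ℝ (k + 1) ((fun e => y' e s) - (A s ∘ fun e => y e s)) Sg :=
    (hy'C s).sub (hAy s)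
  rw [iteratedFDerivWithin_sub_apply ((hd e heS).of_le hle) ((hfy s e heS).of_le hle)
      hSg.uniqueDiffOn heS,
    iteratedFDerivWithin_sub_apply ((hy'C s e heS).of_le hle) ((hAy s e heS).of_le hle)
      hSg.uniqueDiffOn heS,
    (A s).iteratedFDerivWithin_comp_left (hyC s e heS) hSg.uniqueDiffOn heS hle]
  exact hres j h1 hj s e heS

theorem contDiffOn_toBddFam_sub {Sg Ω : Set E} (hSg : IsOpen Sg) (hΩ : IsOpen Ω)
    (hconv : Convex ℝ Ω) (hΩS : Ω ⊆ Sg) {y : E → ℝ → X} {k : ℕ} {M r : ℝ} {e₀ : E} (he₀ : e₀ ∈ Ω)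
    (hr : ∀ e ∈ Ω, ‖e - e₀‖ ≤ r) (hM : 0 ≤ M)
    (hyC : ∀ t, ContDiffOn ℝ (k + 1) (fun e => y e t) Sg)
    (hyM : ∀ j : ℕ, 1 ≤ j → j ≤ k + 1 → ∀ s, ∀ e ∈ Ω,
      ‖iteratedFDerivWithin ℝ j (fun m => y m s) Sg e‖ ≤ M) :
    (∀ e ∈ Ω, ∀ s, ‖y e s - y e₀ s‖ ≤ M * r) ∧
      ContDiffOn ℝ k (fun e => toBddFam fun s => y e s - y e₀ s) Ω := by
  have h0 : ∀ e ∈ Ω, ∀ s, ‖y e s - y e₀ s‖ ≤ M * r := by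
    intro e he s
    refine (hconv.norm_image_sub_le_of_norm_fderiv_le (𝕜 := ℝ) (f := fun m => y m s) (C := M)
      (fun a ha => ?_) (fun a ha => ?_) he₀ he).trans ?_
    · exact ((hyC s).contDiffAt (hSg.mem_nhds (hΩS ha))).differentiableAt (by simp)
    · rw [← norm_iteratedFDeriv_one, ← iteratedFDerivWithin_of_isOpen 1 hSg (hΩS ha)]
      exact hyM 1 le_rfl (by omega) s a ha
    · gcongr
      exact hr e he
  refine ⟨h0, contDiffOn_toBddFam hSg hΩ hconv hΩS (B := M)
    (φ := fun s => (fun e => y e s) - fun _ => y e₀ s)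
    (fun s => (hyC s).sub contDiffOn_const) (fun j h1 hj s e he => ?_) h0⟩
  have heS := hΩS he
  have hle : (j : WithTop ℕ∞) ≤ k + 1 := by exact_mod_cast hj
  rw [iteratedFDerivWithin_sub_apply ((hyC s e heS).of_le hle) contDiffWithinAt_const
      hSg.uniqueDiffOn heS, iteratedFDerivWithin_const_of_ne (by omega)]
  simpa using hyM j h1 hj s e he

end SmoothDependence

section Main

variable {X : Type v} [NormedAddCommGroup X] [NormedSpace ℝ X] [CompleteSpace X]
  {E : Type u} [NormedAddCommGroup E] [NormedSpace ℝ E]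
  {A : ℝ → X →L[ℝ] X} {T : ℝ → ℝ → X →L[ℝ] X} {P : ℝ → X →L[ℝ] X} {G : ℝ → ℝ → X →L[ℝ] X}
  {D ρ : ℝ} {Sg : Set E} {f : E → ℝ → X → X} {c eps : ℝ} {y y' x : E → ℝ → X}

theorem contDiffOn_shadowing_of_one_le (hA : Continuous A) (hTid : ∀ s, T s s = 1)
    (hT : ∀ s t, HasDerivAt (fun r => T r s) ((A t).comp (T t s)) t)
    (hcomm : ∀ t s, (T t s).comp (P s) = (P t).comp (T t s))
    (hG : ∀ t s, G t s = if s ≤ t then (T t s).comp (P s) else -((T t s).comp (1 - P s)))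
    (hD : 0 < D) (hρ : 0 < ρ) (hdich : ∀ t s, ‖G t s‖ ≤ D * Real.exp (-ρ * |t - s|))
    (hSg : IsOpen Sg) (hf : ∀ e ∈ Sg, Continuous (fun p : ℝ × X => f e p.1 p.2))
    (hc : 0 ≤ c) (hlip : ∀ e ∈ Sg, ∀ t v w, ‖f e t v - f e t w‖ ≤ c * ‖v - w‖)
    (hq : 2 * D / ρ * c < 1) (hy : ∀ e ∈ Sg, ∀ t, HasDerivAt (y e) (y' e t) t)
    (hpse : ∀ e ∈ Sg, ∀ t, ‖y' e t - A t (y e t) - f e t (y e t)‖ ≤ eps)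
    (hx : ∀ e ∈ Sg, ∀ t, HasDerivAt (x e) (A t (x e t) + f e t (x e t)) t)
    {R₀ : ℝ} (hR₀ : 0 ≤ R₀) (hxR : ∀ e ∈ Sg, ∀ t, ‖x e t - y e t‖ ≤ R₀)
    {k : ℕ} (hk : 1 ≤ k) {C : ℝ} (hC : 0 ≤ C)
    (hfC : ∀ t, ContDiffOn ℝ (k + 1) (fun p : E × X => f p.1 t p.2) (Sg ×ˢ univ))
    (hfbound : ∀ i, 2 ≤ i → i ≤ k + 1 → ∀ t, ∀ e ∈ Sg, ∀ ξ,
      ‖iteratedFDerivWithin ℝ i (fun p : E × X => f p.1 t p.2) (Sg ×ˢ univ) (e, ξ)‖ ≤ C)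
    (hyC : ∀ t, ContDiffOn ℝ (k + 1) (fun e => y e t) Sg)
    (hy'C : ∀ t, ContDiffOn ℝ (k + 1) (fun e => y' e t) Sg)
    (hres : ∀ i : ℕ, 1 ≤ i → i ≤ k + 1 → ∀ t, ∀ e ∈ Sg,
      ‖iteratedFDerivWithin ℝ i (fun m => y' m t) Sg e
        - (A t).compContinuousMultilinearMap (iteratedFDerivWithin ℝ i (fun m => y m t) Sg e)
        - iteratedFDerivWithin ℝ i (fun m => f m t (y m t)) Sg e‖ ≤ C)
    (hM : ∀ e₀ ∈ Sg, ∃ M : ℝ, 1 < M ∧ ∃ S₀ ∈ nhds e₀, S₀ ⊆ Sg ∧ ∀ e ∈ S₀, ∀ i : ℕ, 1 ≤ i →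
      i ≤ k + 1 → ∀ t, ‖iteratedFDerivWithin ℝ i (fun m => y m t) Sg e‖ ≤ M) (t : ℝ) :
    ContDiffOn ℝ k (fun e => x e t) Sg := by
  intro e₀ he₀
  obtain ⟨M, hM1, S₀, hS₀, hS₀S, hyM⟩ := hM e₀ he₀
  obtain ⟨r, hr, hball⟩ := Metric.mem_nhds_iff.1 hS₀
  set Ω := Metric.ball e₀ r
  have hΩ : IsOpen Ω := Metric.isOpen_ball
  have hconv : Convex ℝ Ω := convex_ball e₀ r
  have hΩS : Ω ⊆ Sg := hball.trans hS₀S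
  have he₀Ω : e₀ ∈ Ω := Metric.mem_ball_self hr
  obtain ⟨hY0, hYC⟩ := contDiffOn_toBddFam_sub hSg hΩ hconv hΩS he₀Ω (M := M) (r := r)
    (fun e he => (mem_ball_iff_norm.1 he).le) (by linarith) hyC
    (fun j h1 hj s e he => hyM e (hball he) j h1 hj s)
  have hRC := contDiffOn_toBddFam_residual hSg hΩ hconv hΩS hpse hfC hyC hy'C hres
  have hNC := contDiffOn_toBddFam_increment (R := R₀ + 1) hSg hk hc hC (by linarith) hlip hfC
    hfbound hΩ hconv hΩS (y e₀)
  set Y : E → BddFam ℝ X := fun e => toBddFam fun s => y e s - y e₀ s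
  set r₀ : E → BddFam ℝ X := fun e => toBddFam fun s => y' e s - A s (y e s) - f e s (y e s)
  set N : E × BddFam ℝ X × BddFam ℝ X → BddFam ℝ X := fun d => toBddFam fun s =>
    f d.1 s (d.2.1 s + d.2.2 s + y e₀ s) - f d.1 s (d.2.1 s + y e₀ s)
  have hY : ∀ e ∈ Ω, ∀ s, Y e s = y e s - y e₀ s := fun e he s => toBddFam_apply (hY0 e he) s
  have hr₀ : ∀ e ∈ Ω, ∀ s, r₀ e s = y' e s - A s (y e s) - f e s (y e s) :=
    fun e he s => toBddFam_apply (hpse e (hΩS he)) s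
  have hN : ∀ e ∈ Ω, ∀ (v : BddFam ℝ X) (s : ℝ),
      N (e, Y e, v) s = f e s (y e s + v s) - f e s (y e s) := by
    intro e he v s
    have h : ∀ s, f e s (Y e s + v s + y e₀ s) - f e s (Y e s + y e₀ s)
        = f e s (y e s + v s) - f e s (y e s) := fun s => by
      rw [hY e he, add_right_comm, sub_add_cancel]
    rw [← h s]
    refine toBddFam_apply (B := c * ‖v‖) (fun s => ?_) s
    simp only
    rw [h s]
    refine (hlip e (hΩS he) s _ _).trans ?_
    gcongr
    rw [add_sub_cancel_left]
    exact v.norm_apply_le s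
  let H : E × BddFam ℝ X → BddFam ℝ X := fun p => N (p.1, Y p.1, p.2) - r₀ p.1
  have hH : ∀ e ∈ Ω, ∀ (v : BddFam ℝ X) (s : ℝ),
      H (e, v) s = f e s (y e s + v s) - (y' e s - A s (y e s)) := by
    intro e he v s
    change N (e, Y e, v) s - r₀ e s = _
    rw [hN e he, hr₀ e he]
    abel
  have hyc : ∀ e ∈ Ω, Continuous (y e) := fun e he =>
    continuous_iff_continuousAt.2 fun t => (hy e (hΩS he) t).continuousAt
  have hxc : ∀ e ∈ Ω, Continuous (x e) := fun e he =>
    continuous_iff_continuousAt.2 fun t => (hx e (hΩS he) t).continuousAt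
  have hz : ∀ e : E, ∃ v : measFam X, e ∈ Ω → ∀ s, (v : BddFam ℝ X) s = x e s - y e s := by
    intro e
    by_cases he : e ∈ Ω
    · have h : ∀ s, toBddFam (fun s => x e s - y e s) s = x e s - y e s :=
        toBddFam_apply (hxR e (hΩS he))
      refine ⟨⟨toBddFam fun s => x e s - y e s, ?_⟩, fun _ => h⟩
      change StronglyMeasurable fun s => toBddFam (fun s => x e s - y e s) s
      rw [funext h]
      exact ((hxc e he).sub (hyc e he)).stronglyMeasurable
    · exact ⟨0, fun h => absurd h he⟩
  choose z hz using hz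
  obtain ⟨K, hK, hKint⟩ := exists_greenCLM hD hρ hdich (stronglyMeasurable_green hA hTid hT hcomm hG)
  have hzC : ContDiffOn ℝ k z Ω := by
    refine contDiffOn_of_fixedPoint_measFam (H := H) (R := R₀ + 1) hΩ hk hc (by positivity) hq
      ?_ (fun e he v hv _ => ?_) (fun e he v w _ _ => ?_) hK (fun e he => ?_) (fun e he u hu => ?_)
    · refine (hNC.comp (f := fun p : E × BddFam ℝ X => (p.1, Y p.1, p.2)) ?_
        fun p hp => ⟨hp.1, mem_univ _, hp.2⟩).sub (hRC.comp contDiffOn_fst fun p hp => hp.1)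
      exact contDiffOn_fst.prodMk ((hYC.comp contDiffOn_fst fun p hp => hp.1).prodMk contDiffOn_snd)
    · change StronglyMeasurable fun s => H (e, v) s
      rw [funext (hH e he v)]
      exact (stronglyMeasurable_superposition (hf e (hΩS he))
        ((hyc e he).stronglyMeasurable.add hv)).sub (stronglyMeasurable_defect hA (hy e (hΩS he)))
    · refine lp.norm_le_of_forall_le (by positivity) fun s => ?_
      change ‖H (e, v) s - H (e, w) s‖ ≤ _
      rw [hH e he, hH e he, sub_sub_sub_cancel_right]
      refine (hlip e (hΩS he) s _ _).trans ?_
      gcongr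
      rw [add_sub_add_left_eq_sub]
      exact (v - w).norm_apply_le s
    · refine lt_of_le_of_lt (lp.norm_le_of_forall_le (f := (z e : BddFam ℝ X)) hR₀ fun s => ?_)
        (lt_add_one R₀)
      rw [hz e he]
      exact hxR e (hΩS he) s
    · ext s
      rw [hKint, hu, hz e he, sub_eq_integral_green hA hTid hT hcomm hG hρ hdich (hf e (hΩS he)) hc
        (hlip e (hΩS he)) (hy e (hΩS he)) (hpse e (hΩS he)) (hx e (hΩS he)) (hxR e (hΩS he)) s]
      simp only [hH e he, hz e he, add_sub_cancel]
  have hxz : ContDiffOn ℝ k (fun e => x e t) Ω := by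
    refine (((hyC t).mono hΩS).of_le le_self_add).add
      (((lp.evalCLM ℝ (fun _ : ℝ => X) ⊤ t).comp (measFam X).subtypeL).contDiff.comp_contDiffOn hzC)
      |>.congr fun e he => ?_
    change x e t = y e t + (z e : BddFam ℝ X) t
    rw [hz e he, add_sub_cancel]
  exact (hxz.contDiffAt (hΩ.mem_nhds he₀Ω)).contDiffWithinAt

end Main

section Continuity

open Filter Topology

theorem tendsto_zero_of_le_integral_add {ι : Type*} {l : Filter ι} [l.IsCountablyGenerated]
    {κ : ℝ → ℝ → ℝ} {w δ : ι → ℝ → ℝ} {q B : ℝ} (hκ0 : ∀ t s, 0 ≤ κ t s)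
    (hκ : ∀ t, Integrable (κ t)) (hκq : ∀ t, ∫ s, κ t s = q) (hq1 : q < 1)
    (hw0 : ∀ i t, 0 ≤ w i t) (hwm : ∀ᶠ i in l, AEStronglyMeasurable (w i))
    (hwB : ∀ᶠ i in l, ∀ t, w i t ≤ B)
    (hle : ∀ᶠ i in l, ∀ t, w i t ≤ (∫ s, κ t s * w i s) + δ i t)
    (hδ : ∀ t, Tendsto (fun i => δ i t) l (𝓝 0)) (t : ℝ) :
    Tendsto (fun i => w i t) l (𝓝 0) := by
  have hq0 : 0 ≤ q := hκq 0 ▸ integral_nonneg (hκ0 0)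
  rcases l.eq_or_neBot with rfl | hl
  · exact tendsto_bot
  obtain ⟨i₀, hi₀⟩ := hwB.exists
  have hB0 : 0 ≤ B := (hw0 i₀ 0).trans (hi₀ 0)
  have key : ∀ (j : ℕ) (t : ℝ), Tendsto (fun i => max (w i t - q ^ j * B) 0) l (𝓝 0) := by
    intro j
    induction j with
    | zero =>
      intro t
      refine tendsto_const_nhds.congr' ?_
      filter_upwards [hwB] with i hi
      rw [pow_zero, one_mul, max_eq_right (sub_nonpos.2 (hi t))]
    | succ j ih =>
      intro t
      have hb0 : 0 ≤ q ^ j * B := by positivity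
      have hbd : ∀ᶠ i in l, ∀ s, ‖κ t s * max (w i s - q ^ j * B) 0‖ ≤ κ t s * B := by
        filter_upwards [hwB] with i hi s
        rw [Real.norm_of_nonneg (mul_nonneg (hκ0 t s) (le_max_right _ _))]
        exact mul_le_mul_of_nonneg_left (max_le (by linarith [hi s]) hB0) (hκ0 t s)
      have hms : ∀ᶠ i in l,
          AEStronglyMeasurable fun s => κ t s * max (w i s - q ^ j * B) 0 := by
        filter_upwards [hwm] with i hi
        exact (hκ t).aestronglyMeasurable.mul
          ((hi.sub aestronglyMeasurable_const).sup aestronglyMeasurable_const)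
      have h1 : Tendsto (fun i => ∫ s, κ t s * max (w i s - q ^ j * B) 0) l (𝓝 0) := by
        have := tendsto_integral_filter_of_dominated_convergence (μ := volume)
          (F := fun i s => κ t s * max (w i s - q ^ j * B) 0) (f := fun _ => (0 : ℝ))
          (fun s => κ t s * B) hms (hbd.mono fun i hi => Eventually.of_forall hi)
          ((hκ t).mul_const B)
          (Eventually.of_forall fun s => by simpa using (ih s).const_mul (κ t s))
        simpa using this
      have h2 : Tendsto (fun i => (∫ s, κ t s * max (w i s - q ^ j * B) 0) + |δ i t|) l (𝓝 0) := by
        simpa using h1.add (hδ t).abs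
      refine tendsto_of_tendsto_of_tendsto_of_le_of_le' tendsto_const_nhds h2
        (Eventually.of_forall fun i => le_max_right _ _) ?_
      filter_upwards [hle, hbd, hms, hwB, hwm] with i hi hib him hiB hiw
      have hint : Integrable fun s => κ t s * max (w i s - q ^ j * B) 0 :=
        Integrable.mono' ((hκ t).mul_const B) him (Eventually.of_forall hib)
      have h3 : ∫ s, κ t s * w i s
          ≤ ∫ s, (κ t s * max (w i s - q ^ j * B) 0 + κ t s * (q ^ j * B)) := by
        refine integral_mono_of_nonneg (Eventually.of_forall fun s => mul_nonneg (hκ0 t s) (hw0 i s))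
          (hint.add ((hκ t).mul_const _)) (Eventually.of_forall fun s => ?_)
        simp only
        rw [← mul_add]
        exact mul_le_mul_of_nonneg_left (by linarith [le_max_left (w i s - q ^ j * B) 0]) (hκ0 t s)
      rw [integral_add hint ((hκ t).mul_const _), integral_mul_const, hκq] at h3
      have h4 : 0 ≤ ∫ s, κ t s * max (w i s - q ^ j * B) 0 :=
        integral_nonneg fun s => mul_nonneg (hκ0 t s) (le_max_right _ _)
      refine max_le ?_ (add_nonneg h4 (abs_nonneg _))
      have h5 := hi t
      have h6 := le_abs_self (δ i t)
      rw [pow_succ', mul_assoc]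
      linarith
  have hpow : Tendsto (fun j : ℕ => q ^ j * B) atTop (𝓝 0) := by
    simpa using (tendsto_pow_atTop_nhds_zero_of_lt_one hq0 hq1).mul_const B
  rw [Metric.tendsto_nhds]
  intro ε hε
  obtain ⟨j, hj⟩ := (hpow.eventually (gt_mem_nhds (half_pos hε))).exists
  filter_upwards [(key j t).eventually (gt_mem_nhds (half_pos hε))] with i hi
  rw [Real.dist_eq, sub_zero, abs_of_nonneg (hw0 i t)]
  linarith [le_max_left (w i t - q ^ j * B) 0]

variable {X : Type*} [NormedAddCommGroup X] [NormedSpace ℝ X] [CompleteSpace X]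
  {E : Type*} [NormedAddCommGroup E]
  {A : ℝ → X →L[ℝ] X} {T : ℝ → ℝ → X →L[ℝ] X} {P : ℝ → X →L[ℝ] X} {G : ℝ → ℝ → X →L[ℝ] X}
  {D ρ : ℝ} {Sg : Set E} {f : E → ℝ → X → X} {c eps : ℝ} {y y' x : E → ℝ → X}

theorem continuousOn_shadowing (hA : Continuous A) (hTid : ∀ s, T s s = 1)
    (hT : ∀ s t, HasDerivAt (fun r => T r s) ((A t).comp (T t s)) t)
    (hcomm : ∀ t s, (T t s).comp (P s) = (P t).comp (T t s))
    (hG : ∀ t s, G t s = if s ≤ t then (T t s).comp (P s) else -((T t s).comp (1 - P s)))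
    (hD : 0 < D) (hρ : 0 < ρ) (hdich : ∀ t s, ‖G t s‖ ≤ D * Real.exp (-ρ * |t - s|))
    (hf : ∀ e ∈ Sg, Continuous (fun p : ℝ × X => f e p.1 p.2))
    (hc : 0 ≤ c) (hlip : ∀ e ∈ Sg, ∀ t v w, ‖f e t v - f e t w‖ ≤ c * ‖v - w‖)
    (hq : 2 * D / ρ * c < 1) (hy : ∀ e ∈ Sg, ∀ t, HasDerivAt (y e) (y' e t) t)
    (hpse : ∀ e ∈ Sg, ∀ t, ‖y' e t - A t (y e t) - f e t (y e t)‖ ≤ eps)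
    (hx : ∀ e ∈ Sg, ∀ t, HasDerivAt (x e) (A t (x e t) + f e t (x e t)) t)
    {R : ℝ} (hxR : ∀ e ∈ Sg, ∀ t, ‖x e t - y e t‖ ≤ R)
    (hfC : ∀ t, ContinuousOn (fun p : E × X => f p.1 t p.2) (Sg ×ˢ univ))
    (hyC : ∀ t, ContinuousOn (fun e => y e t) Sg)
    (hy'C : ∀ t, ContinuousOn (fun e => y' e t) Sg) (t : ℝ) :
    ContinuousOn (fun e => x e t) Sg := by
  intro e₀ he₀
  have hGm := stronglyMeasurable_green hA hTid hT hcomm hG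
  have hyc : ∀ e ∈ Sg, Continuous (y e) := fun e he =>
    continuous_iff_continuousAt.2 fun t => (hy e he t).continuousAt
  have hxc : ∀ e ∈ Sg, Continuous (x e) := fun e he =>
    continuous_iff_continuousAt.2 fun t => (hx e he t).continuousAt
  let z : E → ℝ → X := fun e t => x e t - y e t
  have hzc : ∀ e ∈ Sg, Continuous (z e) := fun e he => (hxc e he).sub (hyc e he)
  let h : E → (ℝ → X) → ℝ → X := fun e v s =>
    f e s (y e s + v s) - (y' e s - A s (y e s))
  have hzint : ∀ e ∈ Sg, ∀ t, z e t = ∫ s, G t s (h e (z e) s) := fun e he t => by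
    simp only [h, z, add_sub_cancel]
    exact sub_eq_integral_green hA hTid hT hcomm hG hρ hdich (hf e he) hc
      (hlip e he) (hy e he) (hpse e he) (hx e he) (hxR e he) t
  have hhB : ∀ e ∈ Sg, ∀ e' ∈ Sg, ∀ s, ‖h e (z e') s‖ ≤ c * R + eps := fun e he e' he' s => by
    refine (norm_sub_defect_le (hlip e he) (hpse e he) s _).trans ?_
    gcongr
    rw [add_sub_cancel_left]
    exact hxR e' he' s
  have hhm : ∀ e ∈ Sg, ∀ e' ∈ Sg, StronglyMeasurable (h e (z e')) := fun e he e' he' =>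
    (stronglyMeasurable_superposition (hf e he)
      ((hyc e he).add (hzc e' he')).stronglyMeasurable).sub (stronglyMeasurable_defect hA (hy e he))
  have hGi : ∀ e ∈ Sg, ∀ e' ∈ Sg, ∀ t, Integrable fun s => G t s (h e (z e') s) :=
    fun e he e' he' t => integrable_green hρ hdich hGm (hhm e he e' he') (hhB e he e' he') t
  have hδ : ∀ t, Tendsto (fun e => ∫ s, G t s (h e (z e₀) s)) (𝓝[Sg] e₀) (𝓝 (z e₀ t)) := by
    intro t
    rw [hzint e₀ he₀ t]
    refine tendsto_integral_filter_of_dominated_convergence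
      (fun s => D * Real.exp (-ρ * |t - s|) * (c * R + eps)) ?_ ?_
      (((integrable_exp_neg_mul_abs_sub hρ t).const_mul D).mul_const _)
      (Eventually.of_forall fun s => ?_)
    · filter_upwards [self_mem_nhdsWithin] with e he using (hGi e he e₀ he₀ t).aestronglyMeasurable
    · filter_upwards [self_mem_nhdsWithin] with e he
      exact Eventually.of_forall fun s => norm_green_apply_le hdich (hhB e he e₀ he₀) t s
    · refine ((G t s).continuous.tendsto _).comp ?_
      have h1 : ContinuousOn (fun e => f e s (y e s + z e₀ s)) Sg :=
        (hfC s).comp (f := fun e => (e, y e s + z e₀ s))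
          (continuousOn_id.prodMk ((hyC s).add continuousOn_const)) fun e he => ⟨he, mem_univ _⟩
      exact (h1.sub ((hy'C s).sub ((A s).continuous.comp_continuousOn (hyC s)))) e₀ he₀
  have hw : ∀ t, Tendsto (fun e => ‖z e t - z e₀ t‖) (𝓝[Sg] e₀) (𝓝 0) := by
    refine tendsto_zero_of_le_integral_add (B := 2 * R)
      (κ := fun t s => D * Real.exp (-ρ * |t - s|) * c)
      (δ := fun e t => ‖(∫ s, G t s (h e (z e₀) s)) - z e₀ t‖) (fun t s => by positivity)
      (fun t => ((integrable_exp_neg_mul_abs_sub hρ t).const_mul D).mul_const c) (fun t => ?_) hq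
      (fun _ _ => norm_nonneg _) ?_ ?_ ?_ (fun t => tendsto_iff_norm_sub_tendsto_zero.1 (hδ t))
    · rw [integral_mul_const, integral_const_mul, integral_exp_neg_mul_abs_sub hρ]
      ring
    · filter_upwards [self_mem_nhdsWithin] with e he
      exact ((hzc e he).sub (hzc e₀ he₀)).norm.aestronglyMeasurable
    · filter_upwards [self_mem_nhdsWithin] with e he t
      exact (norm_sub_le _ _).trans (by rw [two_mul]; exact add_le_add (hxR e he t) (hxR e₀ he₀ t))
    · filter_upwards [self_mem_nhdsWithin] with e he t
      have h1 : z e t - z e₀ t = (∫ s, (G t s (h e (z e) s) - G t s (h e (z e₀) s)))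
          + ((∫ s, G t s (h e (z e₀) s)) - z e₀ t) := by
        rw [integral_sub (hGi e he e he t) (hGi e he e₀ he₀ t), ← hzint e he t]
        abel
      rw [h1]
      refine (norm_add_le _ _).trans (add_le_add_left ?_ _)
      refine norm_integral_le_of_norm_le ?_ (Eventually.of_forall fun s => ?_)
      · refine Integrable.mono' (g := fun s => D * Real.exp (-ρ * |t - s|) * c * (2 * R))
          ((((integrable_exp_neg_mul_abs_sub hρ t).const_mul D).mul_const c).mul_const _) ?_
          (Eventually.of_forall fun s => ?_)
        · exact Continuous.aestronglyMeasurable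
            (((by fun_prop : Continuous fun s => D * Real.exp (-ρ * |t - s|) * c)).mul
              ((hzc e he).sub (hzc e₀ he₀)).norm)
        · rw [Real.norm_of_nonneg (by positivity)]
          gcongr
          exact (norm_sub_le _ _).trans
            (by rw [two_mul]; exact add_le_add (hxR e he s) (hxR e₀ he₀ s))
      · rw [← map_sub, mul_assoc]
        refine (G t s).le_of_opNorm_le_of_le (hdich t s) ?_
        simp only [h]
        rw [sub_sub_sub_cancel_right]
        refine (hlip e he s _ _).trans_eq ?_
        rw [add_sub_add_left_eq_sub]
  have hzt : Tendsto (fun e => z e t) (𝓝[Sg] e₀) (𝓝 (z e₀ t)) :=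
    tendsto_iff_norm_sub_tendsto_zero.2 (hw t)
  have hyz : Tendsto (fun e => y e t + z e t) (𝓝[Sg] e₀) (𝓝 (y e₀ t + z e₀ t)) :=
    Tendsto.add (hyC t e₀ he₀) hzt
  simpa only [z, add_sub_cancel, ContinuousWithinAt] using hyz

end Continuity

/-- Corollary: `C^k` parameterized Hyers–Ulam stability. Under an
exponential dichotomy with `q̃ = 2cD/ρ < 1`, if `y_λ` are `ε`-approximate solutions
with shadowing solutions `x_λ`, and the regularity conditions (i) and (ii) hold with
constant bounds `C`, then for each `t ∈ ℝ` the map `λ ↦ x_λ(t)` is `C^k` on `Σ`. -/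
theorem stmt11
    {X : Type*} [NormedAddCommGroup X] [NormedSpace ℝ X] [CompleteSpace X]
    {E : Type*} [NormedAddCommGroup E] [NormedSpace ℝ E]
    (A : ℝ → X →L[ℝ] X) (hA : Continuous A)
    (T : ℝ → ℝ → X →L[ℝ] X)
    (hTid : ∀ s, T s s = 1)
    (hT : ∀ s t, HasDerivAt (fun r => T r s) ((A t).comp (T t s)) t)
    -- exponential dichotomy
    (P : ℝ → X →L[ℝ] X)
    (hproj : ∀ t, (P t).comp (P t) = P t)
    (hcomm : ∀ t s, (T t s).comp (P s) = (P t).comp (T t s))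
    (G : ℝ → ℝ → X →L[ℝ] X)
    (hG : ∀ t s, G t s = if s ≤ t then (T t s).comp (P s)
      else -((T t s).comp (1 - P s)))
    (D ρ : ℝ) (hD : 0 < D) (hρ : 0 < ρ)
    (hdich : ∀ t s, ‖G t s‖ ≤ D * Real.exp (-ρ * |t - s|))
    -- parameter set and nonlinearity
    (Sg : Set E) (hSg : IsOpen Sg) (hSgne : Sg.Nonempty)
    (f : E → ℝ → X → X)
    (hf : ∀ lam ∈ Sg, Continuous (fun p : ℝ × X => f lam p.1 p.2))
    (c : ℝ) (hc0 : 0 ≤ c)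
    (hlip : ∀ lam ∈ Sg, ∀ t (x₁ x₂ : X),
      ‖f lam t x₁ - f lam t x₂‖ ≤ c * ‖x₁ - x₂‖)
    (hq : 2 * c * D / ρ < 1)
    -- approximate solutions
    (eps : ℝ) (heps : 0 < eps)
    (y : E → ℝ → X) (y' : E → ℝ → X)
    (hy : ∀ lam ∈ Sg, ∀ t, HasDerivAt (y lam) (y' lam t) t)
    (hpse : ∀ lam ∈ Sg, ∀ t,
      ‖y' lam t - A t (y lam t) - f lam t (y lam t)‖ ≤ eps)
    -- the shadowing solutions x_λ
    (x : E → ℝ → X)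
    (hxsol : ∀ lam ∈ Sg, ∀ t, HasDerivAt (x lam) (A t (x lam t) + f lam t (x lam t)) t)
    (hxshad : ∀ lam ∈ Sg, ∀ t,
      ‖x lam t - y lam t‖ ≤ (2 * eps * D / ρ) / (1 - 2 * c * D / ρ))
    (k : ℕ) (C : ℝ) (hC : 0 < C)
    -- (i): (λ,x) ↦ f_λ(t,x) is C^{k+1} with mixed partials of order 2 ≤ i ≤ k+1
    -- bounded by C
    (hfC : ∀ t, ContDiffOn ℝ ((k : ℕ∞) + 1) (fun p : E × X => f p.1 t p.2) (Sg ×ˢ univ))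
    (hfbound : ∀ i : ℕ, 2 ≤ i → i ≤ k + 1 → ∀ t : ℝ, ∀ lam ∈ Sg, ∀ ξ : X,
      ‖iteratedFDerivWithin ℝ i (fun p : E × X => f p.1 t p.2) (Sg ×ˢ univ) (lam, ξ)‖
        ≤ C)
    -- (ii): λ ↦ y_λ(t), λ ↦ y_λ'(t) are C^{k+1} with
    -- ‖∂^i_λ y_λ'(t) − A(t)∂^i_λ y_λ(t) − d^i/dλ^i f_λ(t,y_λ(t))‖ ≤ C
    (hyC : ∀ t, ContDiffOn ℝ ((k : ℕ∞) + 1) (fun lam => y lam t) Sg)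
    (hy'C : ∀ t, ContDiffOn ℝ ((k : ℕ∞) + 1) (fun lam => y' lam t) Sg)
    (hR2 : ∀ i : ℕ, 1 ≤ i → i ≤ k + 1 → ∀ t : ℝ, ∀ lam ∈ Sg,
      ‖iteratedFDerivWithin ℝ i (fun mu => y' mu t) Sg lam
        - (A t).compContinuousMultilinearMap
            (iteratedFDerivWithin ℝ i (fun mu => y mu t) Sg lam)
        - iteratedFDerivWithin ℝ i (fun mu => f mu t (y mu t)) Sg lam‖ ≤ C)
    (hM : ∀ lam₀ ∈ Sg, ∃ M : ℝ, 1 < M ∧ ∃ S₀ ∈ nhds lam₀, S₀ ⊆ Sg ∧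
      ∀ lam ∈ S₀, ∀ i : ℕ, 1 ≤ i → i ≤ k + 1 → ∀ t : ℝ,
        ‖iteratedFDerivWithin ℝ i (fun mu => y mu t) Sg lam‖ ≤ M) :
    ∀ t : ℝ, ContDiffOn ℝ (k : ℕ∞) (fun lam => x lam t) Sg := by
  have hq' : 2 * D / ρ * c < 1 := by
    rwa [show 2 * D / ρ * c = 2 * c * D / ρ by ring]
  obtain ⟨e₀, he₀⟩ := hSgne
  have hR₀ := (norm_nonneg _).trans (hxshad e₀ he₀ 0)
  intro t
  rcases Nat.eq_zero_or_pos k with rfl | hk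
  · have h := continuousOn_shadowing hA hTid hT hcomm hG hD hρ hdich hf hc0 hlip hq' hy hpse
      hxsol hxshad (fun t => (hfC t).continuousOn) (fun t => (hyC t).continuousOn)
      (fun t => (hy'C t).continuousOn) t
    simpa using (contDiffOn_zero (𝕜 := ℝ)).2 h
  · exact contDiffOn_shadowing_of_one_le hA hTid hT hcomm hG hD hρ hdich hSg hf hc0 hlip hq' hy
      hpse hxsol hR₀ hxshad hk hC.le hfC hfbound hyC hy'C hR2 hM t
end

section
/- Assume the linear difference equation x_{n+1} = A_n x_n admits no nontrivial bounded solution on ℤ, that q̂ < 1, and that L̂ < ∞. Then for each λ ∈ Σ and each sequence (y^λ_n)_{n∈ℤ} in X satisfying |y^λ_{n+1} − A_n y^λ_n − f_λ(n, y^λ_n)| ≤ ε_n for all n ∈ ℤ, there exists a unique sequence (x^λ_n)_{n∈ℤ} in X satisfying x^λ_{n+1} = A_n x^λ_n + f_λ(n, x^λ_n) for all n ∈ ℤ and |x^λ_n − y^λ_n| ≤ L̂/(1−q̂) for every n ∈ ℤ. -/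
open Set

theorem norm_apply_le_of_lipschitz {X : Type*} [NormedAddCommGroup X] (h : ℤ → X → X)
    (c eps : ℤ → ℝ) (hc : ∀ n, 0 ≤ c n)
    (hh0 : ∀ n, ‖h n 0‖ ≤ eps n) (hh : ∀ n u v, ‖h n u - h n v‖ ≤ c n * ‖u - v‖)
    {z : ℤ → X} {M : ℝ} (hz : ∀ n, ‖z n‖ ≤ M) (n : ℤ) :
    ‖h n (z n)‖ ≤ eps n + c n * M := by
  have h1 := norm_le_norm_add_norm_sub' (h n (z n)) (h n 0)
  have h2 := hh n (z n) 0
  rw [sub_zero] at h2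
  have h3 := mul_le_mul_of_nonneg_left (hz n) (hc n)
  linarith [hh0 n]

section GreenOperator

variable {X : Type*} [NormedAddCommGroup X] [NormedSpace ℝ X]

theorem green_succ (A : ℤ → X ≃L[ℝ] X) (𝒜 : ℤ → ℤ → X →L[ℝ] X) (h𝒜id : ∀ n, 𝒜 n n = 1)
    (h𝒜 : ∀ m n, 𝒜 (m + 1) n = (A m : X →L[ℝ] X).comp (𝒜 m n))
    (P : ℤ → X →L[ℝ] X) (G : ℤ → ℤ → X →L[ℝ] X)
    (hG : ∀ m n, G m n = if n ≤ m then (𝒜 m n).comp (P n)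
      else -((𝒜 m n).comp (1 - P n)))
    (m n : ℤ) (v : X) :
    G (m + 1) n v = A m (G m n v) + if n = m + 1 then v else 0 := by
  rw [hG, hG]
  rcases lt_trichotomy n (m + 1) with h | rfl | h
  · simp [h𝒜, h.le, h.ne, Int.lt_add_one_iff.mp h]
  · have hA (w : X) : A m (𝒜 m (m + 1) w) = w :=
      DFunLike.congr_fun ((h𝒜 m (m + 1)).symm.trans (h𝒜id _)) w
    simp [h𝒜id, hA]
  · simp [h𝒜, h.not_ge, h.ne', show ¬ n ≤ m by omega]

/-- Convolution with a Green function `G` sends a forcing term `h` to a solution of the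
inhomogeneous equation. -/
theorem tsum_green_succ (A : ℤ → X ≃L[ℝ] X) (G : ℤ → ℤ → X →L[ℝ] X)
    (hG : ∀ m n v, G (m + 1) n v = A m (G m n v) + if n = m + 1 then v else 0)
    (h : ℤ → X) (m : ℤ) (hs : Summable fun n => G m n (h (n - 1))) :
    ∑' n, G (m + 1) n (h (n - 1)) = A m (∑' n, G m n (h (n - 1))) + h m := by
  have h1 := hs.hasSum.mapL (A m : X →L[ℝ] X)
  have h2 := hasSum_ite_eq (m + 1) (h m)
  refine Eq.trans (tsum_congr fun n => ?_) (h1.add h2).tsum_eq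
  rw [hG]
  split_ifs with hn <;> simp [hn]

theorem norm_tsum_green_apply_le (G : ℤ → ℤ → X →L[ℝ] X) (b : ℤ → ℝ) (h : ℤ → X) (m : ℤ)
    (hb : Summable fun n => b (n - 1) * ‖G m n‖) (hh : ∀ n, ‖h n‖ ≤ b n) :
    ‖∑' n, G m n (h (n - 1))‖ ≤ ∑' n, b (n - 1) * ‖G m n‖ :=
  tsum_of_norm_bounded hb.hasSum fun n => ((G m n).le_opNorm _).trans <| by
    rw [mul_comm]; gcongr; exact hh _

theorem norm_tsum_green_apply_lipschitz_le (G : ℤ → ℤ → X →L[ℝ] X) (h : ℤ → X → X)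
    (c eps : ℤ → ℝ) (q L : ℝ) (hc : ∀ n, 0 ≤ c n)
    (hqsum : ∀ m, Summable fun n : ℤ => c (n - 1) * ‖G m n‖)
    (hq : ∀ m, ∑' n : ℤ, c (n - 1) * ‖G m n‖ ≤ q)
    (hLsum : ∀ m, Summable fun n : ℤ => eps (n - 1) * ‖G m n‖)
    (hL : ∀ m, ∑' n : ℤ, eps (n - 1) * ‖G m n‖ ≤ L)
    (hh0 : ∀ n, ‖h n 0‖ ≤ eps n) (hh : ∀ n u v, ‖h n u - h n v‖ ≤ c n * ‖u - v‖)
    {z : ℤ → X} {M : ℝ} (hz : ∀ n, ‖z n‖ ≤ M) (m : ℤ) :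
    ‖∑' n, G m n (h (n - 1) (z (n - 1)))‖ ≤ L + q * M := by
  have hM : 0 ≤ M := (norm_nonneg _).trans (hz 0)
  have hs : HasSum (fun n => (eps (n - 1) + c (n - 1) * M) * ‖G m n‖)
      (∑' n, eps (n - 1) * ‖G m n‖ + (∑' n, c (n - 1) * ‖G m n‖) * M) := by
    convert (hLsum m).hasSum.add ((hqsum m).hasSum.mul_right M) using 2 with n
    ring
  have := norm_tsum_green_apply_le G (fun n => eps n + c n * M) (fun n => h n (z n)) m
    hs.summable (norm_apply_le_of_lipschitz h c eps hc hh0 hh hz)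
  rw [hs.tsum_eq] at this
  exact this.trans (add_le_add (hL m) (mul_le_mul_of_nonneg_right (hq m) hM))

variable [CompleteSpace X]

theorem summable_green_apply (G : ℤ → ℤ → X →L[ℝ] X) (b : ℤ → ℝ) (h : ℤ → X) (m : ℤ)
    (hb : Summable fun n => b (n - 1) * ‖G m n‖) (hh : ∀ n, ‖h n‖ ≤ b n) :
    Summable fun n => G m n (h (n - 1)) :=
  .of_norm_bounded hb fun n => ((G m n).le_opNorm _).trans <| by
    rw [mul_comm]; gcongr; exact hh _

theorem summable_green_apply_lipschitz (G : ℤ → ℤ → X →L[ℝ] X) (h : ℤ → X → X)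
    (c eps : ℤ → ℝ) (hc : ∀ n, 0 ≤ c n)
    (hqsum : ∀ m, Summable fun n : ℤ => c (n - 1) * ‖G m n‖)
    (hLsum : ∀ m, Summable fun n : ℤ => eps (n - 1) * ‖G m n‖)
    (hh0 : ∀ n, ‖h n 0‖ ≤ eps n) (hh : ∀ n u v, ‖h n u - h n v‖ ≤ c n * ‖u - v‖)
    {z : ℤ → X} {M : ℝ} (hz : ∀ n, ‖z n‖ ≤ M) (m : ℤ) :
    Summable fun n => G m n (h (n - 1) (z (n - 1))) :=
  summable_green_apply G (fun n => eps n + c n * M) (fun n => h n (z n)) m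
    (((hLsum m).add ((hqsum m).mul_right M)).congr fun n => by ring)
    (norm_apply_le_of_lipschitz h c eps hc hh0 hh hz)

/-- Well-posedness in the space of bounded sequences of the fixed point equation
`z m = ∑' n, G m n (h (n - 1) (z (n - 1)))`, for a Lipschitz nonlinearity `h` whose total
Lipschitz constant against `G` is less than one. -/
theorem existsUnique_bounded_green_fixedPoint (G : ℤ → ℤ → X →L[ℝ] X) (h : ℤ → X → X)
    (c eps : ℤ → ℝ) (q L : ℝ) (hc : ∀ n, 0 ≤ c n) (hq1 : q < 1)
    (hqsum : ∀ m, Summable fun n : ℤ => c (n - 1) * ‖G m n‖)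
    (hq : ∀ m, ∑' n : ℤ, c (n - 1) * ‖G m n‖ ≤ q)
    (hLsum : ∀ m, Summable fun n : ℤ => eps (n - 1) * ‖G m n‖)
    (hL : ∀ m, ∑' n : ℤ, eps (n - 1) * ‖G m n‖ ≤ L)
    (hh0 : ∀ n, ‖h n 0‖ ≤ eps n) (hh : ∀ n u v, ‖h n u - h n v‖ ≤ c n * ‖u - v‖) :
    ∃! z : ℤ → X, (∀ m, z m = ∑' n, G m n (h (n - 1) (z (n - 1)))) ∧
      ∀ m, ‖z m‖ ≤ L / (1 - q) := by
  have hq0 : 0 ≤ q := (tsum_nonneg fun n => by have := hc (n - 1); positivity).trans (hq 0)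
  have hsum {z : ℤ → X} {M : ℝ} (hz : ∀ n, ‖z n‖ ≤ M) (m : ℤ) :=
    summable_green_apply_lipschitz G h c eps hc hqsum hLsum hh0 hh hz m
  have hbound {z : ℤ → X} {M : ℝ} (hz : ∀ n, ‖z n‖ ≤ M) (m : ℤ) :=
    norm_tsum_green_apply_lipschitz_le G h c eps q L hc hqsum hq hLsum hL hh0 hh hz m
  have hcontr {z w : ℤ → X} {M N D : ℝ} (hz : ∀ n, ‖z n‖ ≤ M) (hw : ∀ n, ‖w n‖ ≤ N)
      (hD : ∀ n, ‖z n - w n‖ ≤ D) (m : ℤ) :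
      ‖∑' n, G m n (h (n - 1) (z (n - 1))) - ∑' n, G m n (h (n - 1) (w (n - 1)))‖ ≤
        q * D := by
    have hD0 : 0 ≤ D := (norm_nonneg _).trans (hD 0)
    have hs : HasSum (fun n => c (n - 1) * D * ‖G m n‖)
        ((∑' n, c (n - 1) * ‖G m n‖) * D) :=
      by
      simpa only [mul_right_comm] using (hqsum m).hasSum.mul_right D
    have := norm_tsum_green_apply_le G (fun n => c n * D) (fun n => h n (z n) - h n (w n)) m
      hs.summable fun n => (hh n _ _).trans (mul_le_mul_of_nonneg_left (hD n) (hc n))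
    rw [hs.tsum_eq] at this
    simp only [map_sub] at this
    rw [(hsum hz m).tsum_sub (hsum hw m)] at this
    exact this.trans (mul_le_mul_of_nonneg_right (hq m) hD0)
  let T (z : BoundedContinuousFunction ℤ X) : BoundedContinuousFunction ℤ X :=
    .ofNormedAddCommGroupDiscrete (fun m => ∑' n, G m n (h (n - 1) (z (n - 1))))
      (L + q * ‖z‖) (hbound z.norm_coe_le_norm)
  have hT : ContractingWith ⟨q, hq0⟩ T := by
    refine ⟨hq1, LipschitzWith.of_dist_le_mul fun z w => ?_⟩
    refine (BoundedContinuousFunction.dist_le (mul_nonneg hq0 dist_nonneg)).mpr fun m => ?_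
    rw [dist_eq_norm]
    exact hcontr z.norm_coe_le_norm w.norm_coe_le_norm
      (fun n => (dist_eq_norm (z n) (w n)).symm.trans_le (z.dist_coe_le_dist n)) m
  let z := ContractingWith.fixedPoint T hT
  have hz : T z = z := hT.fixedPoint_isFixedPt
  refine ⟨z, ⟨fun m => (DFunLike.congr_fun hz m).symm, fun m => ?_⟩, fun w hw => ?_⟩
  · have hL0 : 0 ≤ L + q * ‖z‖ := (norm_nonneg _).trans (hbound z.norm_coe_le_norm 0)
    have hle : ‖z‖ ≤ L + q * ‖z‖ := (BoundedContinuousFunction.norm_le hL0).mpr fun n => by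
      conv_lhs => rw [← hz]
      exact hbound z.norm_coe_le_norm n
    refine (z.norm_coe_le_norm m).trans ((le_div_iff₀ (by linarith)).mpr ?_)
    linarith
  · let w' : BoundedContinuousFunction ℤ X := .ofNormedAddCommGroupDiscrete w _ hw.2
    have hw' : Function.IsFixedPt T w' :=
      BoundedContinuousFunction.ext fun m => (hw.1 m).symm
    exact congrArg DFunLike.coe (hT.fixedPoint_unique hw')

end GreenOperator

/-- Theorem: discrete time shadowing. If `x_{n+1} = A_n x_n` admits
no nontrivial bounded solution, `q̂ < 1` and `L̂ < ∞`, then for each `λ ∈ Σ` every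
approximate solution `(y^λ_n)` of `x_{n+1} = A_n x_n + f_λ(n, x_n)` is shadowed by a
unique exact solution `(x^λ_n)` with `‖x^λ_n − y^λ_n‖ ≤ L̂/(1−q̂)` for all `n`. -/
theorem stmt12
    {X : Type*} [NormedAddCommGroup X] [NormedSpace ℝ X] [CompleteSpace X]
    {E : Type*} [NormedAddCommGroup E] [NormedSpace ℝ E]
    -- the invertible linear operators A_n and the associated cocycle 𝒜
    (A : ℤ → X ≃L[ℝ] X)
    (𝒜 : ℤ → ℤ → X →L[ℝ] X)
    (h𝒜id : ∀ n, 𝒜 n n = 1)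
    (h𝒜 : ∀ m n, 𝒜 (m + 1) n = ((A m : X →L[ℝ] X)).comp (𝒜 m n))
    -- the projections P_n and the Green function Ĝ
    (P : ℤ → X →L[ℝ] X)
    (G : ℤ → ℤ → X →L[ℝ] X)
    (hG : ∀ m n, G m n = if n ≤ m then (𝒜 m n).comp (P n)
      else -((𝒜 m n).comp (1 - P n)))
    -- the parameter set Σ
    (Sg : Set E) (hSg : IsOpen Sg) (hSgne : Sg.Nonempty)
    -- the nonlinearity and its Lipschitz condition
    (f : E → ℤ → X → X)
    (c : ℤ → ℝ) (hc0 : ∀ n, 0 ≤ c n)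
    (hlip : ∀ lam ∈ Sg, ∀ n (x₁ x₂ : X),
      ‖f lam n x₁ - f lam n x₂‖ ≤ c n * ‖x₁ - x₂‖)
    -- q̂ := sup_m Σ_n c_{n−1}‖Ĝ(m,n)‖ < 1
    (q : ℝ) (hq1 : q < 1)
    (hqsum : ∀ m, Summable (fun n : ℤ => c (n - 1) * ‖G m n‖))
    (hq : ∀ m, (∑' n : ℤ, c (n - 1) * ‖G m n‖) ≤ q)
    -- L̂ := sup_m Σ_n ε_{n−1}‖Ĝ(m,n)‖ < ∞
    (eps : ℤ → ℝ) (heps0 : ∀ n, 0 < eps n)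
    (L : ℝ)
    (hLsum : ∀ m, Summable (fun n : ℤ => eps (n - 1) * ‖G m n‖))
    (hL : ∀ m, (∑' n : ℤ, eps (n - 1) * ‖G m n‖) ≤ L)
    -- the linear difference equation has no nontrivial bounded solution
    (hnb : ∀ x : ℤ → X, (∀ n, x (n + 1) = A n (x n)) →
      (∃ M, ∀ n, ‖x n‖ ≤ M) → ∀ n, x n = 0) :
    ∀ lam ∈ Sg, ∀ y : ℤ → X,
      (∀ n, ‖y (n + 1) - A n (y n) - f lam n (y n)‖ ≤ eps n) →
      ∃! x : ℤ → X,
        (∀ n, x (n + 1) = A n (x n) + f lam n (x n)) ∧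
        ∀ n, ‖x n - y n‖ ≤ L / (1 - q) := by
  intro lam hlam y hy
  have hGs := green_succ A 𝒜 h𝒜id h𝒜 P G hG
  let h (n : ℤ) (u : X) : X := A n (y n) + f lam n (y n + u) - y (n + 1)
  have hh0 (n : ℤ) : ‖h n 0‖ ≤ eps n := by
    have h0 : h n 0 = -(y (n + 1) - A n (y n) - f lam n (y n)) := by
      simp only [h, add_zero]
      abel
    rw [h0, norm_neg]
    exact hy n
  have hh (n : ℤ) (u v : X) : ‖h n u - h n v‖ ≤ c n * ‖u - v‖ := by
    simpa [h] using hlip lam hlam n (y n + u) (y n + v)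
  have hsucc {z : ℤ → X} {M : ℝ} (hz : ∀ n, ‖z n‖ ≤ M) (m : ℤ) :=
    tsum_green_succ A G hGs (fun n => h n (z n)) m
      (summable_green_apply_lipschitz G h c eps hc0 hqsum hLsum hh0 hh hz m)
  obtain ⟨z, ⟨hz, hzM⟩, huniq⟩ := existsUnique_bounded_green_fixedPoint G h c eps q L hc0 hq1
    hqsum hq hLsum hL hh0 hh
  refine ⟨y + z, ⟨fun n => ?_, fun n => by simpa using hzM n⟩, fun x hx => ?_⟩
  · have hn := hsucc hzM n
    rw [← hz, ← hz] at hn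
    simp only [Pi.add_apply, hn, h, map_add]
    abel
  · have hxM (n : ℤ) : ‖(x - y) n‖ ≤ L / (1 - q) := hx.2 n
    rw [← huniq (x - y) ⟨fun m => ?_, hxM⟩, add_sub_cancel]
    refine sub_eq_zero.mp (hnb (fun m => (x - y) m -
      ∑' n, G m n (h (n - 1) ((x - y) (n - 1)))) (fun n => ?_)
      ⟨L / (1 - q) + (L + q * (L / (1 - q))), fun n => ?_⟩ m)
    · rw [hsucc hxM n]
      simp only [Pi.sub_apply, hx.1 n, h, map_sub, add_sub_cancel]
      abel
    · exact (norm_sub_le _ _).trans (add_le_add (hxM n)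
        (norm_tsum_green_apply_lipschitz_le G h c eps q L hc0 hqsum hq hLsum hL hh0 hh hxM n))
end

section
/- Assume q̂ < 1 and L̂ < ∞, and for λ ∈ Σ let (y^λ_n)_{n∈ℤ} be a sequence in X with |y^λ_{n+1} − A_n y^λ_n − f_λ(n, y^λ_n)| ≤ ε_n for all n ∈ ℤ. Define (𝒯̂_λ z)_n := Σ_{k∈ℤ} Ĝ(n,k)(A_{k−1} y^λ_{k−1} + f_λ(k−1, z_{k−1} + y^λ_{k−1}) − y^λ_k) for z ∈ 𝒴̂. Then: (i) 𝒯̂_λ maps 𝒴̂ into 𝒴̂ with ‖𝒯̂_λ z‖∞ ≤ L̂ + q̂‖z‖∞ for every z ∈ 𝒴̂; (ii) ‖𝒯̂_λ z¹ − 𝒯̂_λ z²‖∞ ≤ q̂‖z¹ − z²‖∞ for all z¹, z² ∈ 𝒴̂; (iii) consequently 𝒯̂_λ maps the closed ball 𝒟̂ := {z ∈ 𝒴̂ : ‖z‖∞ ≤ L̂/(1−q̂)} into itself and has a unique fixed point in 𝒟̂. -/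
open Set

section OperatorSeries

variable {ι X Y : Type*} [NormedAddCommGroup X] [NormedSpace ℝ X]
  [NormedAddCommGroup Y] [NormedSpace ℝ Y]
  {T : ι → X →L[ℝ] Y} {v : ι → X} {b : ι → ℝ}

lemma norm_clm_apply_le_mul_norm (hv : ∀ k, ‖v k‖ ≤ b k) (k : ι) :
    ‖T k (v k)‖ ≤ b k * ‖T k‖ :=
  ((T k).le_opNorm (v k)).trans <| by
    rw [mul_comm]
    exact mul_le_mul_of_nonneg_right (hv k) (norm_nonneg _)

lemma summable_clm_apply [CompleteSpace Y] (hv : ∀ k, ‖v k‖ ≤ b k)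
    (hb : Summable fun k => b k * ‖T k‖) : Summable fun k => T k (v k) :=
  Summable.of_norm_bounded hb (norm_clm_apply_le_mul_norm hv)

lemma norm_tsum_clm_apply_le (hv : ∀ k, ‖v k‖ ≤ b k)
    (hb : Summable fun k => b k * ‖T k‖) :
    ‖∑' k, T k (v k)‖ ≤ ∑' k, b k * ‖T k‖ :=
  tsum_of_norm_bounded hb.hasSum (norm_clm_apply_le_mul_norm hv)

end OperatorSeries

/-- A contraction of a Banach space satisfying `‖T z‖ ≤ L + q * ‖z‖` has exactly one fixed point
in the closed ball of radius `L / (1 - q)`. -/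
lemma existsUnique_fixedPoint_of_norm_le {Y : Type*} [NormedAddCommGroup Y] [CompleteSpace Y]
    {T : Y → Y} {L q : ℝ} (hq0 : 0 ≤ q) (hq1 : q < 1)
    (hT : ∀ z, ‖T z‖ ≤ L + q * ‖z‖)
    (hlip : ∀ z₁ z₂, ‖T z₁ - T z₂‖ ≤ q * ‖z₁ - z₂‖) :
    ∃! w, ‖w‖ ≤ L / (1 - q) ∧ w = T w := by
  have hcontr : ContractingWith ⟨q, hq0⟩ T := by
    refine ⟨by exact_mod_cast hq1, LipschitzWith.of_dist_le_mul fun z₁ z₂ => ?_⟩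
    rw [dist_eq_norm, dist_eq_norm]
    exact hlip z₁ z₂
  have hfix := hcontr.fixedPoint_isFixedPt
  refine ⟨hcontr.fixedPoint, ⟨?_, hfix.eq.symm⟩, fun w hw => hcontr.fixedPoint_unique hw.2.symm⟩
  have h := hT hcontr.fixedPoint
  rw [hfix.eq] at h
  rw [le_div_iff₀ (by linarith)]
  linarith

/-- properties of the discrete operator
`(𝒯̂_λ z)_n = Σ_k Ĝ(n,k)(A_{k−1}y^λ_{k−1} + f_λ(k−1, z_{k−1}+y^λ_{k−1}) − y^λ_k)` on
the space `𝒴̂` of bounded sequences: (i) it maps `𝒴̂` into `𝒴̂` with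
`‖𝒯̂_λ z‖∞ ≤ L̂ + q̂‖z‖∞`; (ii) it is a `q̂`-contraction; (iii) it maps the closed ball
of radius `L̂/(1−q̂)` into itself and has a unique fixed point there. -/
theorem stmt13
    {X : Type*} [NormedAddCommGroup X] [NormedSpace ℝ X] [CompleteSpace X]
    {E : Type*} [NormedAddCommGroup E] [NormedSpace ℝ E]
    (A : ℤ → X ≃L[ℝ] X)
    (𝒜 : ℤ → ℤ → X →L[ℝ] X)
    (h𝒜id : ∀ n, 𝒜 n n = 1)
    (h𝒜 : ∀ m n, 𝒜 (m + 1) n = ((A m : X →L[ℝ] X)).comp (𝒜 m n))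
    (P : ℤ → X →L[ℝ] X)
    (G : ℤ → ℤ → X →L[ℝ] X)
    (hG : ∀ m n, G m n = if n ≤ m then (𝒜 m n).comp (P n)
      else -((𝒜 m n).comp (1 - P n)))
    (Sg : Set E) (hSg : IsOpen Sg) (hSgne : Sg.Nonempty)
    (f : E → ℤ → X → X)
    (c : ℤ → ℝ) (hc0 : ∀ n, 0 ≤ c n)
    (hlip : ∀ lam ∈ Sg, ∀ n (x₁ x₂ : X),
      ‖f lam n x₁ - f lam n x₂‖ ≤ c n * ‖x₁ - x₂‖)
    (q : ℝ) (hq1 : q < 1)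
    (hqsum : ∀ m, Summable (fun n : ℤ => c (n - 1) * ‖G m n‖))
    (hq : ∀ m, (∑' n : ℤ, c (n - 1) * ‖G m n‖) ≤ q)
    (eps : ℤ → ℝ) (heps0 : ∀ n, 0 < eps n)
    (L : ℝ)
    (hLsum : ∀ m, Summable (fun n : ℤ => eps (n - 1) * ‖G m n‖))
    (hL : ∀ m, (∑' n : ℤ, eps (n - 1) * ‖G m n‖) ≤ L)
    -- the approximate solutions y^λ
    (y : E → ℤ → X)
    (hpse : ∀ lam ∈ Sg, ∀ n,
      ‖y lam (n + 1) - A n (y lam n) - f lam n (y lam n)‖ ≤ eps n)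
    -- the operator 𝒯̂_λ
    (Top : E → BoundedContinuousFunction ℤ X → ℤ → X)
    (hTop : ∀ lam ∈ Sg, ∀ (z : BoundedContinuousFunction ℤ X) (n : ℤ),
      Top lam z n = ∑' k : ℤ, G n k
        (A (k - 1) (y lam (k - 1)) + f lam (k - 1) (z (k - 1) + y lam (k - 1))
          - y lam k)) :
    ∀ lam ∈ Sg,
      -- (i) 𝒯̂_λ maps 𝒴̂ into 𝒴̂ with ‖𝒯̂_λ z‖∞ ≤ L̂ + q̂‖z‖∞
      (∀ z : BoundedContinuousFunction ℤ X, ∀ n, ‖Top lam z n‖ ≤ L + q * ‖z‖) ∧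
      -- (ii) contraction
      (∀ z₁ z₂ : BoundedContinuousFunction ℤ X, ∀ n,
        ‖Top lam z₁ n - Top lam z₂ n‖ ≤ q * ‖z₁ - z₂‖) ∧
      -- (iii) 𝒯̂_λ maps 𝒟̂ into itself and has a unique fixed point in 𝒟̂
      (∀ z : BoundedContinuousFunction ℤ X, ‖z‖ ≤ L / (1 - q) →
        ∀ n, ‖Top lam z n‖ ≤ L / (1 - q)) ∧
      (∃! w : BoundedContinuousFunction ℤ X,
        ‖w‖ ≤ L / (1 - q) ∧ ∀ n, w n = Top lam w n) := by
  intro lam hlam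
  have hq0 : 0 ≤ q := (tsum_nonneg fun n : ℤ =>
    mul_nonneg (hc0 (n - 1)) (norm_nonneg (G 0 n))).trans (hq 0)
  set v : BoundedContinuousFunction ℤ X → ℤ → X := fun z k =>
    A (k - 1) (y lam (k - 1)) + f lam (k - 1) (z (k - 1) + y lam (k - 1)) - y lam k with hv
  have hvdiff : ∀ z₁ z₂ k, ‖v z₁ k - v z₂ k‖ ≤ c (k - 1) * ‖z₁ - z₂‖ := by
    intro z₁ z₂ k
    have h := hlip lam hlam (k - 1) (z₁ (k - 1) + y lam (k - 1)) (z₂ (k - 1) + y lam (k - 1))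
    rw [add_sub_add_right_eq_sub] at h
    calc ‖v z₁ k - v z₂ k‖
        = ‖f lam (k - 1) (z₁ (k - 1) + y lam (k - 1))
            - f lam (k - 1) (z₂ (k - 1) + y lam (k - 1))‖ := by
          simp only [hv]
          congr 1
          abel
      _ ≤ c (k - 1) * ‖z₁ (k - 1) - z₂ (k - 1)‖ := h
      _ ≤ c (k - 1) * ‖z₁ - z₂‖ :=
          mul_le_mul_of_nonneg_left ((z₁ - z₂).norm_coe_le_norm (k - 1)) (hc0 _)
  have hvzero : ∀ k, ‖v 0 k‖ ≤ eps (k - 1) := by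
    intro k
    have h := hpse lam hlam (k - 1)
    rw [sub_add_cancel, ← norm_neg] at h
    have hv0 : v 0 k = -(y lam k - A (k - 1) (y lam (k - 1))
        - f lam (k - 1) (y lam (k - 1))) := by
      simp only [hv, BoundedContinuousFunction.coe_zero, Pi.zero_apply, zero_add]
      abel
    rwa [hv0]
  have hvbound : ∀ z k, ‖v z k‖ ≤ eps (k - 1) + c (k - 1) * ‖z‖ := by
    intro z k
    have h := hvdiff z 0 k
    rw [sub_zero] at h
    have h' := norm_add_le (v 0 k) (v z k - v 0 k)
    rw [add_sub_cancel] at h'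
    linarith [hvzero k]
  have hcsum : ∀ (r : ℝ) n, HasSum (fun k : ℤ => c (k - 1) * r * ‖G n k‖)
      ((∑' k : ℤ, c (k - 1) * ‖G n k‖) * r) := fun r n => by
    simpa only [mul_right_comm] using (hqsum n).hasSum.mul_right r
  have hbsum : ∀ (r : ℝ) n, HasSum (fun k : ℤ => (eps (k - 1) + c (k - 1) * r) * ‖G n k‖)
      ((∑' k : ℤ, eps (k - 1) * ‖G n k‖) + (∑' k : ℤ, c (k - 1) * ‖G n k‖) * r) :=
    fun r n => by simpa only [add_mul] using (hLsum n).hasSum.add (hcsum r n)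
  have hmap : ∀ z : BoundedContinuousFunction ℤ X, ∀ n, ‖Top lam z n‖ ≤ L + q * ‖z‖ := by
    intro z n
    have h := norm_tsum_clm_apply_le (hvbound z) (hbsum ‖z‖ n).summable
    rw [(hbsum ‖z‖ n).tsum_eq] at h
    rw [hTop lam hlam]
    exact h.trans (add_le_add (hL n) (mul_le_mul_of_nonneg_right (hq n) (norm_nonneg _)))
  have hlipTop : ∀ z₁ z₂ : BoundedContinuousFunction ℤ X, ∀ n,
      ‖Top lam z₁ n - Top lam z₂ n‖ ≤ q * ‖z₁ - z₂‖ := by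
    intro z₁ z₂ n
    have h := norm_tsum_clm_apply_le (hvdiff z₁ z₂) (hcsum ‖z₁ - z₂‖ n).summable
    rw [(hcsum ‖z₁ - z₂‖ n).tsum_eq] at h
    simp only [map_sub] at h
    rw [(summable_clm_apply (hvbound z₁) (hbsum ‖z₁‖ n).summable).tsum_sub
      (summable_clm_apply (hvbound z₂) (hbsum ‖z₂‖ n).summable)] at h
    rw [hTop lam hlam, hTop lam hlam]
    exact h.trans (mul_le_mul_of_nonneg_right (hq n) (norm_nonneg _))
  refine ⟨hmap, hlipTop, fun z hz n => ?_, ?_⟩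
  · have hne : 1 - q ≠ 0 := by linarith
    calc ‖Top lam z n‖ ≤ L + q * ‖z‖ := hmap z n
      _ ≤ L + q * (L / (1 - q)) := by gcongr
      _ = L / (1 - q) := by
        field_simp
        ring
  · let T : BoundedContinuousFunction ℤ X → BoundedContinuousFunction ℤ X := fun z =>
      BoundedContinuousFunction.ofNormedAddCommGroupDiscrete (Top lam z) (L + q * ‖z‖) (hmap z)
    have hL0 : 0 ≤ L := (tsum_nonneg fun n : ℤ =>
      mul_nonneg (heps0 (n - 1)).le (norm_nonneg (G 0 n))).trans (hL 0)
    have hT := existsUnique_fixedPoint_of_norm_le (T := T) hq0 hq1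
      (fun z => (BoundedContinuousFunction.norm_le (by positivity)).2 (hmap z))
      (fun z₁ z₂ => (BoundedContinuousFunction.norm_le (by positivity)).2 (hlipTop z₁ z₂))
    simp only [BoundedContinuousFunction.ext_iff] at hT
    exact hT
end
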